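/- For every integer t ≥ 1 there exists a constant C(t) such that the following holds: if H is a t-connected graph with no K_t-minor and |V(H)| ≥ C(t), then H has a spanning tree of maximum degree at most t − 2. -/

import Mathlib

open SimpleGraph

/-- Branch-set definition of graph minors. -/
def IsMinorOf {β α : Type} (H : SimpleGraph β) (G : SimpleGraph α) : Prop :=
  ∃ B : β → Set α,
    (∀ b, (B b).Nonempty) ∧
    (∀ b, (G.induce (B b)).Connected) ∧
    (Pairwise fun b₁ b₂ => Disjoint (B b₁) (B b₂)) ∧
    (∀ b₁ b₂, H.Adj b₁ b₂ → ∃ u ∈ B b₁, ∃ v ∈ B b₂, G.Adj u v)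

/-- `G` is `k`-connected: it has at least `k+1` vertices, and removing any set of at
most `k−1` vertices leaves a connected graph. -/
def KConnected {α : Type} [Fintype α] (k : ℕ) (G : SimpleGraph α) : Prop :=
  k + 1 ≤ Fintype.card α ∧ ∀ S : Set α, S.ncard ≤ k - 1 → (G.induce Sᶜ).Connected

/-- `x` and `y` are joined by a walk of `G` all of whose edges lie inside `K`. -/
def ReachIn {V : Type} (G : SimpleGraph V) (K : Set V) : V → V → Prop :=
  Relation.ReflTransGen fun u v => G.Adj u v ∧ u ∈ K ∧ v ∈ K

/-- Any two vertices of `K` are joined by a walk of `G` inside `K`. -/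
def ConnOn {V : Type} (G : SimpleGraph V) (K : Set V) : Prop :=
  ∀ x ∈ K, ∀ y ∈ K, ReachIn G K x y

namespace ReachIn

variable {V : Type} {G G' : SimpleGraph V} {K K' : Set V} {x y z : V}

lemma refl : ReachIn G K x x := Relation.ReflTransGen.refl

lemma trans (h : ReachIn G K x y) (h' : ReachIn G K y z) : ReachIn G K x z :=
  Relation.ReflTransGen.trans h h'

lemma single (h : G.Adj x y) (hx : x ∈ K) (hy : y ∈ K) : ReachIn G K x y :=
  Relation.ReflTransGen.single ⟨h, hx, hy⟩

lemma symm (h : ReachIn G K x y) : ReachIn G K y x := by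
  induction h with
  | refl => exact refl
  | tail _ h ih => exact (single h.1.symm h.2.2 h.2.1).trans ih

lemma lift {W : Type} {G' : SimpleGraph W} {K' : Set W} (f : V → W)
    (hf : ∀ u ∈ K, ∀ v ∈ K, G.Adj u v → ReachIn G' K' (f u) (f v))
    (h : ReachIn G K x y) : ReachIn G' K' (f x) (f y) := by
  induction h with
  | refl => exact refl
  | tail _ h ih => exact ih.trans (hf _ h.2.1 _ h.2.2 h.1)

lemma of_forall (hf : ∀ u ∈ K, ∀ v ∈ K, G.Adj u v → ReachIn G' K' u v)
    (h : ReachIn G K x y) : ReachIn G' K' x y := h.lift id hf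

lemma mono (hG : G ≤ G') (hK : K ⊆ K') (h : ReachIn G K x y) : ReachIn G' K' x y :=
  h.of_forall fun _ hu _ hv huv => single (hG huv) (hK hu) (hK hv)

lemma of_reachable (h : G.Reachable x y) : ReachIn G Set.univ x y := by
  rw [reachable_iff_reflTransGen] at h
  exact h.lift id fun a b hab => ⟨hab, trivial, trivial⟩

lemma reachable (h : ReachIn G K x y) : G.Reachable x y := by
  induction h with
  | refl => exact Reachable.refl _
  | tail _ h ih => exact ih.trans h.1.reachable

lemma reachable_induce (h : ReachIn G K x y) (hx : x ∈ K) (hy : y ∈ K) :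
    (G.induce K).Reachable ⟨x, hx⟩ ⟨y, hy⟩ := by
  induction h with
  | refl => exact Reachable.refl _
  | tail _ h ih => exact (ih h.2.1).trans (Adj.reachable (by simpa using h.1))

lemma of_reachable_induce {x y : K} (h : (G.induce K).Reachable x y) :
    ReachIn G K x y :=
  (of_reachable h).lift Subtype.val fun u _ v _ huv => single huv u.2 v.2

/-- A walk inside `K` leaving the set `P` uses an edge from `P` to its complement. -/
lemma exists_exit {P : Set V} (h : ReachIn G K x y) (hx : x ∈ P) (hy : y ∉ P) :
    ∃ u ∈ P, ∃ v, v ∉ P ∧ u ∈ K ∧ v ∈ K ∧ G.Adj u v := by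
  induction h with
  | refl => exact absurd hx hy
  | @tail b c _ h ih =>
    by_cases hb : b ∈ P
    · exact ⟨b, hb, c, hy, h.2.1, h.2.2, h.1⟩
    · exact ih hb

end ReachIn

lemma connOn_iff_induce_preconnected {V : Type} {G : SimpleGraph V} {K : Set V} :
    ConnOn G K ↔ (G.induce K).Preconnected :=
  ⟨fun h x y => (h x x.2 y y.2).reachable_induce x.2 y.2,
    fun h x hx y hy => ReachIn.of_reachable_induce (h ⟨x, hx⟩ ⟨y, hy⟩)⟩

lemma ConnOn.induce_connected {V : Type} {G : SimpleGraph V} {K : Set V} (h : ConnOn G K)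
    (hK : K.Nonempty) : (G.induce K).Connected :=
  (connected_iff _).2 ⟨connOn_iff_induce_preconnected.1 h, hK.to_subtype⟩

lemma connOn_of_root {V : Type} {G : SimpleGraph V} {K : Set V} (r : V)
    (h : ∀ x ∈ K, ReachIn G K x r) : ConnOn G K :=
  fun x hx y hy => (h x hx).trans (h y hy).symm

lemma connOn_singleton {V : Type} (G : SimpleGraph V) (x : V) : ConnOn G {x} := by
  rintro y rfl z rfl
  exact .refl

lemma connOn_univ_iff {V : Type} {G : SimpleGraph V} :
    ConnOn G Set.univ ↔ G.Preconnected :=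
  ⟨fun h x y => (h x trivial y trivial).reachable, fun h x _ y _ => .of_reachable (h x y)⟩

/-- The graph obtained by identifying vertices along `q`. -/
def quotientGraph {V W : Type} (G : SimpleGraph V) (q : V → W) : SimpleGraph W where
  Adj a b := a ≠ b ∧ ∃ x y, q x = a ∧ q y = b ∧ G.Adj x y
  symm := ⟨fun _ _ ⟨h, x, y, hx, hy, hxy⟩ => ⟨h.symm, y, x, hy, hx, hxy.symm⟩⟩
  loopless := ⟨fun _ h => h.1 rfl⟩

lemma quotientGraph_adj {V W : Type} {G : SimpleGraph V} {q : V → W} {x y : V}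
    (h : G.Adj x y) (hq : q x ≠ q y) : (quotientGraph G q).Adj (q x) (q y) :=
  ⟨hq, x, y, rfl, rfl, h⟩

lemma ConnOn.preimage_quotient {V W : Type} {G : SimpleGraph V} {q : V → W}
    (hq : ∀ w, ConnOn G (q ⁻¹' {w})) {K : Set W} (hK : ConnOn (quotientGraph G q) K) :
    ConnOn G (q ⁻¹' K) := by
  have key : ∀ a b, ReachIn (quotientGraph G q) K a b → a ∈ K → ∀ x y, q x = a → q y = b →
      ReachIn G (q ⁻¹' K) x y := by
    intro a b h ha
    induction h with
    | refl =>
      intro x y hx hy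
      refine (hq a x hx y hy).mono le_rfl ?_
      rintro z rfl
      exact ha
    | @tail b c _ h ih =>
      intro x y hx hy
      obtain ⟨⟨-, u, v, hu, hv, huv⟩, hb, hc⟩ := h
      refine ((ih x u hx hu).trans (.single huv (by simpa [hu]) (by simpa [hv]))).trans ?_
      refine (hq c v hv y hy).mono le_rfl ?_
      rintro z rfl
      exact hc
  exact fun x hx y hy => key _ _ (hK _ hx _ hy) hx x y rfl rfl

/-- A `K_t`-minor of a quotient with connected fibres gives a `K_t`-minor. -/
lemma IsMinorOf.of_quotientGraph {V W : Type} {G : SimpleGraph V} {q : V → W} {t : ℕ}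
    (ht : 2 ≤ t) (hq : ∀ w, ConnOn G (q ⁻¹' {w}))
    (h : IsMinorOf (⊤ : SimpleGraph (Fin t)) (quotientGraph G q)) :
    IsMinorOf (⊤ : SimpleGraph (Fin t)) G := by
  obtain ⟨B, -, hc, hd, ha⟩ := h
  have : Nontrivial (Fin t) := Fin.nontrivial_iff_two_le.2 ht
  have hne : ∀ b, (q ⁻¹' (B b)).Nonempty := by
    intro b
    obtain ⟨b', hb'⟩ := exists_ne b
    obtain ⟨u, hu, v, hv, -, x, y, hx, hy, -⟩ := ha b b' (by simpa using hb'.symm)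
    exact ⟨x, by simpa [hx]⟩
  refine ⟨fun b => q ⁻¹' (B b), hne, fun b => ?_, fun b b' hb => (hd hb).preimage q, ?_⟩
  · exact (ConnOn.preimage_quotient hq
      (connOn_iff_induce_preconnected.2 (hc b).preconnected)).induce_connected (hne b)
  · intro b b' hb
    obtain ⟨u, hu, v, hv, -, x, y, hx, hy, hxy⟩ := ha b b' hb
    exact ⟨x, by simpa [hx], y, by simpa [hy], hxy⟩

/-- A connected graph with `n` vertices has, for some `c`, a proper colouring onto `c` colours
with `c.choose 2 + n - c` at most the number of edges. -/
lemma exists_surjective_coloring_of_connected (n : ℕ) :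
    ∀ (V : Type) [Fintype V] (R : SimpleGraph V), R.Connected → Fintype.card V = n →
      ∃ (c : ℕ) (p : V → ℕ), Set.range p = Set.Iio c ∧ (∀ x y, R.Adj x y → p x ≠ p y) ∧
        c.choose 2 + n ≤ R.edgeSet.ncard + c := by
  classical
  induction n with
  | zero =>
    intro V _ R hR hV
    have := hR.nonempty
    exact absurd hV Fintype.card_ne_zero
  | succ n ih =>
    intro V _ R hR hV
    rcases Nat.eq_zero_or_pos n with rfl | hn
    · have : Subsingleton V := Fintype.card_le_one_iff_subsingleton.1 hV.le
      obtain ⟨v⟩ := hR.nonempty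
      refine ⟨1, fun _ => 0, ?_, fun x y h => absurd (Subsingleton.elim x y) h.ne, by simp⟩
      ext i
      simp only [Set.mem_range, Set.mem_Iio]
      exact ⟨by rintro ⟨_, rfl⟩; omega, fun h => ⟨v, by omega⟩⟩
    have : Nontrivial V := Fintype.one_lt_card_iff_nontrivial.1 (by omega)
    obtain ⟨v, hv⟩ := hR.exists_connected_induce_compl_singleton_of_finite_nontrivial
    have hcard : Fintype.card ↥({v}ᶜ : Set V) = n := by
      rw [Fintype.card_compl_set]
      simp [hV]
    obtain ⟨c, p, hpc, hp, hle⟩ := ih _ _ hv hcard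
    have hE := (R.card_edgeFinset_induce_compl_singleton v).trans
      (R.card_edgeFinset_deleteIncidenceSet v)
    have hdpos : 0 < R.degree v := hR.preconnected.degree_pos_of_nontrivial v
    have hdE : R.degree v ≤ R.edgeFinset.card := R.degree_le_card_edgeFinset v
    rw [← coe_edgeFinset, Set.ncard_coe_finset] at hle ⊢
    have hmem : ∀ k, k < c ↔ ∃ x, p x = k := fun k => by
      rw [← Set.mem_Iio, ← hpc, Set.mem_range]
    have hproper : ∀ k, (∀ x : ↥({v}ᶜ : Set V), R.Adj v x → p x ≠ k) →
        ∀ x y, R.Adj x y →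
          (if h : x = v then k else p ⟨x, h⟩) ≠ if h : y = v then k else p ⟨y, h⟩ := by
      intro k hk x y hxy
      by_cases hx : x = v
      · subst hx
        have hy : y ≠ x := hxy.ne'
        simp only [dite_true, hy, dite_false]
        exact (hk ⟨y, hy⟩ hxy).symm
      · by_cases hy : y = v
        · subst hy
          simp only [dite_true, hx, dite_false]
          exact hk ⟨x, hx⟩ hxy.symm
        · simp only [hx, hy, dite_false]
          exact hp _ _ (by simpa using hxy)
    by_cases hk : ∃ k < c, ∀ x : ↥({v}ᶜ : Set V), R.Adj v x → p x ≠ k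
    · obtain ⟨k, hkc, hk⟩ := hk
      refine ⟨c, fun x => if h : x = v then k else p ⟨x, h⟩, ?_, hproper k hk, by omega⟩
      ext i
      simp only [Set.mem_range, Set.mem_Iio]
      constructor
      · rintro ⟨x, rfl⟩
        by_cases hx : x = v
        · simpa [hx] using hkc
        · simpa [hx] using (hmem _).2 ⟨⟨x, hx⟩, rfl⟩
      · intro hi
        obtain ⟨x, rfl⟩ := (hmem i).1 hi
        have : (x : V) ≠ v := x.2
        exact ⟨x, by simp [this]⟩
    · push Not at hk
      refine ⟨c + 1, fun x => if h : x = v then c else p ⟨x, h⟩, ?_, hproper c ?_, ?_⟩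
      · ext i
        simp only [Set.mem_range, Set.mem_Iio]
        constructor
        · rintro ⟨x, rfl⟩
          by_cases hx : x = v
          · simp [hx]
          · simpa [hx] using Nat.lt_succ_of_lt ((hmem _).2 ⟨⟨x, hx⟩, rfl⟩)
        · intro hi
          rcases Nat.lt_succ_iff_lt_or_eq.1 hi with hi | rfl
          · obtain ⟨x, rfl⟩ := (hmem i).1 hi
            have : (x : V) ≠ v := x.2
            exact ⟨x, by simp [this]⟩
          · exact ⟨v, by simp⟩
      · intro x _ h
        have := (hmem (p x)).2 ⟨x, rfl⟩
        omega
      · have hdeg : c ≤ R.degree v := by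
          choose! f hf using hk
          have := Finset.card_le_card_of_surjOn (s := R.neighborFinset v) (t := Finset.range c)
            (fun x => if h : x = v then 0 else p ⟨x, h⟩) (by
              intro i hi
              obtain ⟨h1, h2⟩ := hf i (by simpa using hi)
              have : (f i : V) ≠ v := (f i).2
              exact ⟨f i, by simpa using h1, by simpa [this] using h2⟩)
          simpa using this
        have : (c + 1).choose 2 = c + c.choose 2 := by
          rw [Nat.choose_succ_succ' c 1, Nat.choose_one_right]
        omega

/-- Hall's theorem for the members of a finset. -/
lemma exists_injOn_of_hall {ι α : Type} [DecidableEq α] [Nonempty α] (P : Finset ι)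
    (N : ι → Finset α) (h : ∀ s ⊆ P, s.card ≤ (s.biUnion N).card) :
    ∃ f : ι → α, Set.InjOn f P ∧ ∀ x ∈ P, f x ∈ N x := by
  classical
  obtain ⟨f, hf, hfN⟩ := (Finset.all_card_le_biUnion_card_iff_exists_injective
    (fun x : P => N x)).1 (by
      intro s
      have := h (s.map (Function.Embedding.subtype _)) (by
        intro x hx
        obtain ⟨y, -, rfl⟩ := Finset.mem_map.1 hx
        exact y.2)
      rw [Finset.card_map] at this
      refine this.trans (Finset.card_le_card ?_)
      intro b hb
      simp only [Finset.mem_biUnion, Finset.mem_map] at hb ⊢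
      obtain ⟨_, ⟨y, hy, rfl⟩, hb⟩ := hb
      exact ⟨y, hy, hb⟩)
  refine ⟨fun x => if hx : x ∈ P then f ⟨x, hx⟩ else Classical.arbitrary α, ?_, ?_⟩
  · intro x hx y hy hxy
    simp only [Finset.mem_coe] at hx hy
    simp only [hx, hy, dite_true] at hxy
    simpa using hf hxy
  · intro x hx
    simpa [hx] using hfN ⟨x, hx⟩

/-- A nonempty pairwise intersecting triangle-free family of pairs is a star. -/
lemma card_lt_of_intersecting {V : Type} [DecidableEq V] {F : Finset (Sym2 V)}
    (hF : F.Nonempty) (U : Finset V)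
    (hdiag : ∀ e ∈ F, ¬ e.IsDiag) (hU : ∀ e ∈ F, ∀ v ∈ e, v ∈ U)
    (hint : ∀ e ∈ F, ∀ f ∈ F, ∃ z ∈ e, z ∈ f)
    (htri : ∀ a b c, s(a, b) ∈ F → s(a, c) ∈ F → s(b, c) ∈ F → False) :
    F.card < U.card := by
  obtain ⟨c, hc⟩ : ∃ c, ∀ e ∈ F, c ∈ e := by
    by_contra! hno
    obtain ⟨e, he⟩ := hF
    induction e with
    | _ a b =>
      obtain ⟨f, hf, haf⟩ := hno a
      obtain ⟨z, hz, hzf⟩ := hint _ he f hf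
      obtain rfl : z = b := by
        rcases Sym2.mem_iff.1 hz with rfl | h
        exacts [absurd hzf haf, h]
      obtain ⟨d, rfl⟩ := Sym2.mem_iff_exists.1 hzf
      obtain ⟨k, hk, hbk⟩ := hno z
      obtain ⟨w, hw, hwk⟩ := hint _ he k hk
      obtain rfl : w = a := by
        rcases Sym2.mem_iff.1 hw with h | rfl
        exacts [h, absurd hwk hbk]
      obtain ⟨u, hu, huk⟩ := hint _ hf k hk
      obtain rfl : u = d := by
        rcases Sym2.mem_iff.1 hu with rfl | h
        exacts [absurd huk hbk, h]
      have hwu : w ≠ u := by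
        rintro rfl
        exact haf (Sym2.mem_mk_right _ _)
      rw [(Sym2.mem_and_mem_iff hwu).1 ⟨hwk, huk⟩] at hk
      exact htri w z u he hk hf
  have hcU : c ∈ U := by
    obtain ⟨e, he⟩ := hF
    exact hU e he c (hc e he)
  calc F.card ≤ ((U.erase c).image fun v => s(c, v)).card := by
        refine Finset.card_le_card fun e he => ?_
        obtain ⟨v, rfl⟩ := Sym2.mem_iff_exists.1 (hc e he)
        refine Finset.mem_image.2 ⟨v, Finset.mem_erase.2 ⟨?_, hU _ he v (Sym2.mem_mk_right _ _)⟩, rfl⟩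
        rintro rfl
        exact hdiag _ he rfl
    _ ≤ (U.erase c).card := Finset.card_image_le
    _ < U.card := Finset.card_erase_lt_of_mem hcU

section Cover

variable {V β : Type} [Fintype V] [DecidableEq V]

/-- The members of `B` whose trace contains both ends of `e`. -/
def pairTraces (B : Finset β) (T : β → Finset V) (e : Sym2 V) : Finset β :=
  B.filter fun b => ∀ x ∈ e, x ∈ T b

/-- Identifying vertices of `V` destroys many traces: all maps with at least two
values are non-injective on at least `(n - 3) * (n - c)` traces, where `c` is the number of
values. -/
def RichTraces (B : Finset β) (T : β → Finset V) : Prop :=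
  ∀ p : V → V, 2 ≤ (Finset.univ.image p).card →
    (Fintype.card V - 3) * (Fintype.card V - (Finset.univ.image p).card) ≤
      (B.filter fun b => ¬ Set.InjOn p (T b)).card

variable {B : Finset β} {T : β → Finset V}

lemma mem_pairTraces {e : Sym2 V} {b : β} :
    b ∈ pairTraces B T e ↔ b ∈ B ∧ ∀ x ∈ e, x ∈ T b := by
  simp [pairTraces]

/-- `g` assigns to each pair in `P` a member whose trace contains the pair, injectively up to
pairs through the vertex `z`. -/
def AssignsTraces (B : Finset β) (T : β → Finset V) (P : Finset (Sym2 V)) (g : Sym2 V → β)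
    (z : V) : Prop :=
  (∀ e ∈ P, g e ∈ pairTraces B T e) ∧
    ∀ e ∈ P, ∀ e' ∈ P, g e = g e' → e = e' ∨ (z ∈ e ∧ z ∈ e')

/-- Reassigning the traces of `e`, `f` and a pair `k` meeting both. -/
lemma exists_assignsTraces_of_swap {Q : Finset (Sym2 V)} {e f k : Sym2 V} {μ : Sym2 V → β}
    (hinj : Set.InjOn μ (Q.erase e)) (hmem : ∀ u ∈ Q.erase e, μ u ∈ pairTraces B T u)
    (hf : f ∈ Q) (hk : k ∈ Q) (hfe : f ≠ e) (hke : k ≠ e) (hkf : k ≠ f)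
    (he' : μ f ∈ pairTraces B T e) (hk' : μ f ∈ pairTraces B T k) {x y : V} (hxe : x ∈ e)
    (hxk : x ∈ k) (hyf : y ∈ f) (hyk : y ∈ k)
    (h : μ k ∈ pairTraces B T e ∨ μ k ∈ pairTraces B T f) :
    ∃ g z, AssignsTraces B T Q g z := by
  have hinj' : ∀ u ∈ Q, u ≠ e → ∀ v ∈ Q, v ≠ e → μ u = μ v → u = v := fun u hu hue v hv hve =>
    hinj (by simp [hu, hue]) (by simp [hv, hve])
  have hmem' : ∀ u ∈ Q, u ≠ e → μ u ∈ pairTraces B T u := fun u hu hue =>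
    hmem u (by simp [hu, hue])
  clear hinj hmem
  rcases h with h | h
  · refine ⟨fun u => if u = k then μ f else if u = e then μ k else μ u, y, ?_, ?_⟩
    · intro u hu
      have := hmem' u hu
      grind
    · intro u hu v hv
      have h1 := hinj' u hu
      have h2 := hinj' v hv
      grind
  · refine ⟨fun u => if u = k then μ f else if u = e then μ f else if u = f then μ k else μ u,
      x, ?_, ?_⟩
    · intro u hu
      have := hmem' u hu
      grind
    · intro u hu v hv
      have h1 := hinj' u hu
      have h2 := hinj' v hv
      grind

variable [DecidableEq β]

lemma RichTraces.le_card_biUnion (h : RichTraces B T) (p : V → V) (Q : Finset (Sym2 V)) (j : ℕ)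
    (h2 : 2 ≤ (Finset.univ.image p).card)
    (hj : j + (Finset.univ.image p).card ≤ Fintype.card V)
    (hQ : ∀ u v, u ≠ v → p u = p v → s(u, v) ∈ Q) :
    (Fintype.card V - 3) * j ≤ (Q.biUnion (pairTraces B T)).card := by
  refine (Nat.mul_le_mul_left _ (by omega)).trans ((h p h2).trans (Finset.card_le_card ?_))
  intro b hb
  simp only [Finset.mem_filter, Set.InjOn, not_forall] at hb
  obtain ⟨hbB, u, hu, v, hv, huv, hne⟩ := hb
  simp only [Finset.mem_biUnion, pairTraces, Finset.mem_filter]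
  refine ⟨s(u, v), hQ u v hne huv, hbB, ?_⟩
  intro x hx
  rcases Sym2.mem_iff.1 hx with rfl | rfl
  exacts [hu, hv]

/-- The bound on the traces hit by a set `Q` of non-edges of a connected graph. -/
lemma RichTraces.exists_bound (h : RichTraces B T) (hn : 2 ≤ Fintype.card V)
    {R₀ : SimpleGraph V} (hR : R₀.Connected) (Q : Finset (Sym2 V))
    (hQ : ∀ e ∈ Q, e ∈ R₀ᶜ.edgeSet) :
    ∃ c j, c + j = Fintype.card V ∧ 2 ≤ c ∧ 2 * Q.card + 3 * j ≤ j * (2 * c + j) ∧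
      (Fintype.card V - 3) * j ≤ (Q.biUnion (pairTraces B T)).card := by
  classical
  have hQd : ∀ u v, s(u, v) ∈ Q → u ≠ v := fun u v huv => by
    have : R₀ᶜ.Adj u v := hQ _ huv
    exact this.ne
  let F : SimpleGraph V := fromEdgeSet (Q : Set (Sym2 V))
  have hFadj : ∀ u v, F.Adj u v ↔ s(u, v) ∈ Q := fun u v => by
    simp only [F, fromEdgeSet_adj, Finset.mem_coe]
    exact ⟨fun h => h.1, fun h => ⟨h, hQd u v h⟩⟩
  have hle : R₀ ≤ Fᶜ := by
    intro u v huv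
    rw [compl_adj, hFadj]
    refine ⟨huv.ne, fun h => ?_⟩
    have : R₀ᶜ.Adj u v := hQ _ h
    exact ((compl_adj _ _ _).1 this).2 huv
  have hcard : Fᶜ.edgeSet.ncard + Q.card = (Fintype.card V).choose 2 := by
    have hF : F.edgeFinset = Q := by
      ext e
      induction e with
      | _ u v => rw [mem_edgeFinset, mem_edgeSet, hFadj]
    rw [← card_edgeFinset_top_eq_card_choose_two, ← coe_edgeFinset, Set.ncard_coe_finset,
      ← congrArg Finset.card hF, ← Finset.card_union_of_disjoint
        (disjoint_edgeFinset.2 (disjoint_compl_right (a := F)).symm), ← edgeFinset_sup]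
    congr 1
    ext e
    rw [mem_edgeFinset, mem_edgeFinset, sup_comm, sup_compl_eq_top]
  obtain ⟨c, p, hpc, hp, hE⟩ :=
    exists_surjective_coloring_of_connected _ V Fᶜ (hR.mono hle) rfl
  have hFc := hR.mono hle
  have hne : Nonempty V := hR.nonempty
  have hpim : (Finset.univ.image p) = Finset.range c := by
    apply Finset.coe_injective
    simp [hpc]
  have himg : (Finset.univ.image (Function.invFun p ∘ p)).card = c := by
    rw [← Finset.image_image, Finset.card_image_of_injOn, hpim, Finset.card_range]
    intro i hi k hk hik
    simp only [Finset.coe_image, Finset.coe_univ, Set.image_univ, Set.mem_range] at hi hk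
    rw [← Function.invFun_eq hi, ← Function.invFun_eq hk]
    exact congrArg p hik
  have hcn : c ≤ Fintype.card V := by
    rw [← himg]; exact Finset.card_le_univ _
  have hc2 : 2 ≤ c := by
    have : Nontrivial V := Fintype.one_lt_card_iff_nontrivial.1 (by omega)
    obtain ⟨v⟩ := hne
    obtain ⟨w, hw⟩ := hFc.preconnected.exists_adj_of_nontrivial v
    have h1 := hp v w hw
    have hv : p v < c := by rw [← Set.mem_Iio, ← hpc]; exact ⟨v, rfl⟩
    have hw : p w < c := by rw [← Set.mem_Iio, ← hpc]; exact ⟨w, rfl⟩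
    omega
  obtain ⟨j, hj⟩ := Nat.exists_eq_add_of_le hcn
  refine ⟨c, j, hj.symm, hc2, ?_, ?_⟩
  · have e1 : (c + j).choose 2 * 2 + (c + j) = (c + j) * (c + j) := by
      rw [Nat.choose_two_right, Nat.div_mul_cancel (Nat.even_mul_pred_self _).two_dvd]
      cases h : c + j with
      | zero => simp
      | succ m => simp; ring
    have e2 : c.choose 2 * 2 + c = c * c := by
      rw [Nat.choose_two_right, Nat.div_mul_cancel (Nat.even_mul_pred_self _).two_dvd]
      cases c with
      | zero => simp
      | succ m => simp; ring
    rw [hj] at hE hcard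
    nlinarith
  · refine h.le_card_biUnion (Function.invFun p ∘ p) Q j (by omega) (by omega) ?_
    intro u v huv hpuv
    have : p u = p v := by
      have := congrArg p hpuv
      simpa [Function.invFun_eq (f := p) ⟨u, rfl⟩, Function.invFun_eq (f := p) ⟨v, rfl⟩] using this
    by_contra hnot
    exact hp u v (by rw [compl_adj, hFadj]; exact ⟨huv, hnot⟩) this

lemma AssignsTraces.exists_centers {P : Finset (Sym2 V)} {g : Sym2 V → β} {z : V}
    (h : AssignsTraces B T P g z) :
    ∃ c : β → Option V, (∀ b x, c b = some x → b ∈ B ∧ x ∈ T b) ∧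
      ∀ x y, s(x, y) ∈ P → ∃ b, (c b = some x ∧ y ∈ T b) ∨ (c b = some y ∧ x ∈ T b) := by
  classical
  have key : ∀ b, ∃ v, ∀ e ∈ P, g e = b → v ∈ e := by
    intro b
    by_cases hz : ∀ e ∈ P, g e = b → z ∈ e
    · exact ⟨z, hz⟩
    push Not at hz
    obtain ⟨e, he, hb, hze⟩ := hz
    refine ⟨e.out.1, fun e' he' hb' => ?_⟩
    rcases h.2 e he e' he' (hb.trans hb'.symm) with rfl | h'
    · exact Sym2.out_fst_mem e
    · exact absurd h'.1 hze
  choose v hv using key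
  refine ⟨fun b => if b ∈ B ∧ v b ∈ T b then some (v b) else none, ?_, ?_⟩
  · intro b x hx
    dsimp only at hx
    split_ifs at hx with hb
    simp only [Option.some.injEq] at hx
    exact hx ▸ hb
  · intro x y hxy
    have h1 := mem_pairTraces.1 (h.1 _ hxy)
    have h2 := hv _ _ hxy rfl
    refine ⟨g s(x, y), ?_⟩
    dsimp only
    rw [if_pos ⟨h1.1, h1.2 _ h2⟩]
    rcases Sym2.mem_iff.1 h2 with h3 | h3
    · exact .inl ⟨by rw [h3], h1.2 _ (Sym2.mem_mk_right x y)⟩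
    · exact .inr ⟨by rw [h3], h1.2 _ (Sym2.mem_mk_left x y)⟩

lemma AssignsTraces.extend [Nonempty β] {P Q : Finset (Sym2 V)} {g : Sym2 V → β} {z : V}
    (hQP : Q ⊆ P) (h : AssignsTraces B T Q g z)
    (hQ : (Q.biUnion (pairTraces B T)).card < Q.card)
    (hbd : ∀ s ⊆ P, s.card ≤ (s.biUnion (pairTraces B T)).card + 1) :
    ∃ g' : Sym2 V → β, AssignsTraces B T P g' z := by
  classical
  obtain ⟨f, hf, hfN⟩ := exists_injOn_of_hall (P \ Q)
    (fun e => pairTraces B T e \ Q.biUnion (pairTraces B T)) (by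
      intro s hs
      have h1 := hbd (s ∪ Q) (Finset.union_subset (hs.trans Finset.sdiff_subset) hQP)
      have hd : Disjoint s Q := Finset.disjoint_of_subset_left hs Finset.sdiff_disjoint
      rw [Finset.card_union_of_disjoint hd] at h1
      have h2 : ((s ∪ Q).biUnion (pairTraces B T)).card ≤
          (s.biUnion fun e => pairTraces B T e \ Q.biUnion (pairTraces B T)).card +
            (Q.biUnion (pairTraces B T)).card := by
        refine (Finset.card_le_card ?_).trans (Finset.card_union_le _ _)
        intro b hb
        simp only [Finset.mem_biUnion, Finset.mem_union, Finset.mem_sdiff] at hb ⊢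
        grind
      omega)
  refine ⟨fun e => if e ∈ Q then g e else f e, ?_, ?_⟩
  · intro e he
    by_cases heQ : e ∈ Q
    · simpa [heQ] using h.1 e heQ
    · simpa [heQ] using (Finset.mem_sdiff.1 (hfN e (by simp [he, heQ]))).1
  · have hcross : ∀ e ∈ Q, ∀ e' ∈ P \ Q, g e ≠ f e' := by
      intro e he e' he' heq
      have := (Finset.mem_sdiff.1 (hfN e' he')).2
      exact this (heq ▸ Finset.mem_biUnion.2 ⟨e, he, h.1 e he⟩)
    intro e he e' he' heq
    by_cases heQ : e ∈ Q <;> by_cases heQ' : e' ∈ Q <;> simp only [heQ, heQ', if_true, if_false] at heq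
    · exact h.2 e heQ e' heQ' heq
    · exact absurd heq (hcross e heQ e' (by simp [he', heQ']))
    · exact absurd heq.symm (hcross e' heQ' e (by simp [he, heQ]))
    · exact .inl (hf (by simp [he, heQ]) (by simp [he', heQ']) heq)

lemma card_add_card_image_le (p : V → V) (M : Finset V) (h : ∀ v, p v ∉ M) :
    M.card + (Finset.univ.image p).card ≤ Fintype.card V := by
  rw [← Finset.card_union_of_disjoint]
  · exact Finset.card_le_univ _
  · rw [Finset.disjoint_left]
    intro a ha ha'
    obtain ⟨v, -, rfl⟩ := Finset.mem_image.1 ha'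
    exact h v ha

lemma two_le_card_image (p : V → V) {u v : V} (h : p u ≠ p v) :
    2 ≤ (Finset.univ.image p).card :=
  Finset.one_lt_card.2 ⟨p u, by simp, p v, by simp, h⟩

lemma RichTraces.two_disjoint (h : RichTraces B T) {x₁ y₁ x₂ y₂ : V}
    (hd : [x₁, y₁, x₂, y₂].Nodup) {Q : Finset (Sym2 V)} (h₁ : s(x₁, y₁) ∈ Q)
    (h₂ : s(x₂, y₂) ∈ Q) :
    (Fintype.card V - 3) * 2 ≤ (Q.biUnion (pairTraces B T)).card := by
  simp only [List.nodup_cons, List.mem_cons, List.not_mem_nil, or_false, not_or] at hd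
  let p : V → V := fun v => if v = y₁ then x₁ else if v = y₂ then x₂ else v
  refine h.le_card_biUnion p Q 2 (two_le_card_image p (u := x₁) (v := x₂) ?_) ?_ ?_
  · grind
  · have := card_add_card_image_le p {y₁, y₂} (by grind)
    rwa [Finset.card_pair (by grind)] at this
  · intro u v huv hp
    have e₁ := Sym2.eq_swap (a := x₁) (b := y₁)
    have e₂ := Sym2.eq_swap (a := x₂) (b := y₂)
    simp only [p] at hp
    grind

lemma RichTraces.three_disjoint (h : RichTraces B T) {x₁ y₁ x₂ y₂ x₃ y₃ : V}
    (hd : [x₁, y₁, x₂, y₂, x₃, y₃].Nodup) {Q : Finset (Sym2 V)} (h₁ : s(x₁, y₁) ∈ Q)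
    (h₂ : s(x₂, y₂) ∈ Q) (h₃ : s(x₃, y₃) ∈ Q) :
    (Fintype.card V - 3) * 3 ≤ (Q.biUnion (pairTraces B T)).card := by
  simp only [List.nodup_cons, List.mem_cons, List.not_mem_nil, or_false, not_or] at hd
  let p : V → V := fun v => if v = y₁ then x₁ else if v = y₂ then x₂ else
    if v = y₃ then x₃ else v
  refine h.le_card_biUnion p Q 3 (two_le_card_image p (u := x₁) (v := x₂) ?_) ?_ ?_
  · grind
  · have := card_add_card_image_le p {y₁, y₂, y₃} (by grind)
    rwa [Finset.card_eq_three.2 ⟨y₁, y₂, y₃, by grind, by grind, by grind, rfl⟩] at this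
  · intro u v huv hp
    have e₁ := Sym2.eq_swap (a := x₁) (b := y₁)
    have e₂ := Sym2.eq_swap (a := x₂) (b := y₂)
    have e₃ := Sym2.eq_swap (a := x₃) (b := y₃)
    simp only [p] at hp
    grind

lemma RichTraces.triangle_disjoint (h : RichTraces B T) {x y a b c : V}
    (hd : [x, y, a, b, c].Nodup) {Q : Finset (Sym2 V)} (h₀ : s(x, y) ∈ Q)
    (h₁ : s(a, b) ∈ Q) (h₂ : s(a, c) ∈ Q) (h₃ : s(b, c) ∈ Q) :
    (Fintype.card V - 3) * 3 ≤ (Q.biUnion (pairTraces B T)).card := by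
  simp only [List.nodup_cons, List.mem_cons, List.not_mem_nil, or_false, not_or] at hd
  let p : V → V := fun v => if v = y then x else if v = b then a else
    if v = c then a else v
  refine h.le_card_biUnion p Q 3 (two_le_card_image p (u := x) (v := a) ?_) ?_ ?_
  · grind
  · have := card_add_card_image_le p {y, b, c} (by grind)
    rwa [Finset.card_eq_three.2 ⟨y, b, c, by grind, by grind, by grind, rfl⟩] at this
  · intro u v huv hp
    have e₀ := Sym2.eq_swap (a := x) (b := y)
    have e₁ := Sym2.eq_swap (a := a) (b := b)
    have e₂ := Sym2.eq_swap (a := a) (b := c)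
    have e₃ := Sym2.eq_swap (a := b) (b := c)
    simp only [p] at hp
    grind

lemma RichTraces.two_disjoint' (h : RichTraces B T) {e f : Sym2 V} (he : ¬ e.IsDiag)
    (hf : ¬ f.IsDiag) (hef : ∀ z ∈ e, z ∉ f) :
    (Fintype.card V - 3) * 2 ≤ (pairTraces B T e ∪ pairTraces B T f).card := by
  induction e with
  | _ a b =>
  induction f with
  | _ c d =>
  have := h.two_disjoint (Q := {s(a, b), s(c, d)}) (x₁ := a) (y₁ := b) (x₂ := c) (y₂ := d)
    (by simp at *; grind) (by simp) (by simp)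
  simpa using this

lemma RichTraces.three_disjoint' (h : RichTraces B T) {Q : Finset (Sym2 V)}
    (hQ : ∀ e ∈ Q, ¬ e.IsDiag) {e f k : Sym2 V} (he : e ∈ Q) (hf : f ∈ Q) (hk : k ∈ Q)
    (hef : ∀ z ∈ e, z ∉ f) (hek : ∀ z ∈ e, z ∉ k) (hfk : ∀ z ∈ f, z ∉ k) :
    (Fintype.card V - 3) * 3 ≤ (Q.biUnion (pairTraces B T)).card := by
  have he' := hQ e he
  have hf' := hQ f hf
  have hk' := hQ k hk
  induction e with
  | _ a b =>
  induction f with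
  | _ c d =>
  induction k with
  | _ x y =>
  exact h.three_disjoint (by simp at *; grind) he hf hk

/-- A minimal family of pairs violating Hall's condition by one still has an assignment in which
two pairs with a common vertex share a trace. -/
lemma RichTraces.exists_assignsTraces_of_tight [Nonempty β] (h : RichTraces B T)
    (hn : 4 ≤ Fintype.card V) {Q : Finset (Sym2 V)} (hQ : ∀ e ∈ Q, ¬ e.IsDiag)
    (hcard : Q.card = (Q.biUnion (pairTraces B T)).card + 1)
    (hmin : ∀ s ⊂ Q, s.card ≤ (s.biUnion (pairTraces B T)).card)
    (hone : ∀ e ∈ Q, Fintype.card V - 3 ≤ (pairTraces B T e).card)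
    (hval : Q.card = Fintype.card V - 2 ∨ Q.card = 2 * Fintype.card V - 5) :
    ∃ g z, AssignsTraces B T Q g z := by
  by_contra! hno
  have hμ : ∀ e ∈ Q, ∃ μ : Sym2 V → β, Set.InjOn μ (Q.erase e) ∧
      (∀ f ∈ Q.erase e, μ f ∈ pairTraces B T f) ∧
      ∀ b ∈ Q.biUnion (pairTraces B T), ∃ f ∈ Q.erase e, μ f = b := by
    intro e he
    obtain ⟨μ, hμ, hμN⟩ := exists_injOn_of_hall (Q.erase e) (pairTraces B T) fun s hs =>
      hmin s (hs.trans_ssubset (Finset.erase_ssubset he))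
    refine ⟨μ, hμ, hμN, fun b hb => ?_⟩
    have himg : (Q.erase e).image μ = Q.biUnion (pairTraces B T) := by
      refine Finset.eq_of_subset_of_card_le ?_ ?_
      · intro b hb
        obtain ⟨f, hf, rfl⟩ := Finset.mem_image.1 hb
        exact Finset.mem_biUnion.2 ⟨f, Finset.mem_of_mem_erase hf, hμN f hf⟩
      · rw [Finset.card_image_of_injOn hμ, Finset.card_erase_of_mem he]
        omega
    rw [← himg] at hb
    simpa using hb
  choose! μ hinj hmem hsurj using hμ
  have hsub : ∀ e ∈ Q, ∀ b ∈ pairTraces B T e, b ∈ Q.biUnion (pairTraces B T) :=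
    fun e he b hb => Finset.mem_biUnion.2 ⟨e, he, hb⟩
  have hdisj : ∀ e ∈ Q, ∀ f ∈ Q, f ≠ e → μ e f ∈ pairTraces B T e → ∀ z ∈ e, z ∉ f := by
    intro e he f hf hfe hb z hze hzf
    refine hno (fun u => if u = e then μ e f else μ e u) z ⟨?_, ?_⟩
    · intro u hu
      have := hmem e he u
      grind
    · intro u hu v hv
      have := hinj e he
      simp only [Set.InjOn, Finset.coe_erase, Set.mem_sdiff, Finset.mem_coe,
        Set.mem_singleton_iff] at this
      grind
  have hex : ∀ e ∈ Q, ∀ b ∈ pairTraces B T e, ∃ f ∈ Q, f ≠ e ∧ μ e f = b := by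
    intro e he b hb
    obtain ⟨f, hf, hfb⟩ := hsurj e he b (hsub e he b hb)
    exact ⟨f, Finset.mem_of_mem_erase hf, Finset.ne_of_mem_erase hf, hfb⟩
  have hval' : Q.card = 2 * Fintype.card V - 5 := by
    refine hval.resolve_left fun hval => ?_
    obtain ⟨e, he⟩ : Q.Nonempty := Finset.card_pos.1 (by omega)
    obtain ⟨b, hb⟩ : (pairTraces B T e).Nonempty := Finset.card_pos.1 (by have := hone e he; omega)
    obtain ⟨f, hf, hfe, rfl⟩ := hex e he b hb
    have h1 := h.two_disjoint' (hQ e he) (hQ f hf) (hdisj e he f hf hfe hb)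
    have h2 : (pairTraces B T e ∪ pairTraces B T f).card ≤ (Q.biUnion (pairTraces B T)).card :=
      Finset.card_le_card fun b hb => (Finset.mem_union.1 hb).elim (hsub e he b) (hsub f hf b)
    omega
  have hcov : ∀ e ∈ Q, ∀ f ∈ Q, (∀ z ∈ e, z ∉ f) → ∀ b ∈ Q.biUnion (pairTraces B T),
      b ∈ pairTraces B T e ∨ b ∈ pairTraces B T f := by
    intro e he f hf hef b hb
    have h1 := h.two_disjoint' (hQ e he) (hQ f hf) hef
    rw [← Finset.mem_union, Finset.eq_of_subset_of_card_le (t := Q.biUnion (pairTraces B T))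
      (fun b hb => (Finset.mem_union.1 hb).elim (hsub e he b) (hsub f hf b)) (by omega)]
    exact hb
  have hmeet : ∀ e ∈ Q, ∀ f ∈ Q, f ≠ e → μ e f ∈ pairTraces B T e → ∀ k ∈ Q,
      ∀ x ∈ e, x ∈ k → ∀ y ∈ f, y ∉ k := by
    intro e he f hf hfe hb k hk x hxe hxk y hyf hyk
    have hd := hdisj e he f hf hfe hb
    have hke : k ≠ e := fun h => hd y (h ▸ hyk) hyf
    have hkf : k ≠ f := fun h => hd x hxe (h ▸ hxk)
    have hxy : x ≠ y := fun h => hd x hxe (h ▸ hyf)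
    have hbf : μ e f ∈ pairTraces B T f := hmem e he f (Finset.mem_erase.2 ⟨hfe, hf⟩)
    have hbk : μ e f ∈ pairTraces B T k := by
      rw [(Sym2.mem_and_mem_iff hxy).1 ⟨hxk, hyk⟩]
      rw [mem_pairTraces] at hb hbf ⊢
      refine ⟨hb.1, fun z hz => ?_⟩
      rcases Sym2.mem_iff.1 hz with rfl | rfl
      exacts [hb.2 _ hxe, hbf.2 _ hyf]
    have hk' := hmem e he k (Finset.mem_erase.2 ⟨hke, hk⟩)
    obtain ⟨g, z, hg⟩ := exists_assignsTraces_of_swap (hinj e he) (hmem e he) hf hk hfe hke hkf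
      hb hbk hxe hxk hyf hyk (hcov e he f hf hd (μ e k) (hsub k hk _ hk'))
    exact hno g z hg
  have hN3 : (Q.biUnion (pairTraces B T)).card < (Fintype.card V - 3) * 3 := by omega
  have hiso : ∀ e ∈ Q, ∀ k ∈ Q, k ≠ e → ∀ z ∈ e, z ∉ k := by
    intro e he k hk hke z hze hzk
    obtain ⟨y, rfl⟩ := Sym2.mem_iff_exists.1 hze
    obtain ⟨v, rfl⟩ := Sym2.mem_iff_exists.1 hzk
    have hzy : z ≠ y := hQ _ he
    have hzv : z ≠ v := hQ _ hk
    have hyv : y ≠ v := fun h => hke (h ▸ rfl)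
    let F := (Q.erase s(z, y)).filter fun f => μ s(z, y) f ∈ pairTraces B T s(z, y)
    have hF : ∀ f ∈ F, f ∈ Q ∧ f ≠ s(z, y) ∧ μ s(z, y) f ∈ pairTraces B T s(z, y) := by
      intro f hf
      simp only [F, Finset.mem_filter, Finset.mem_erase] at hf
      exact ⟨hf.1.2, hf.1.1, hf.2⟩
    have hFcard : Fintype.card V - 3 ≤ F.card := by
      refine ((hone _ he).trans (Finset.card_le_card ?_)).trans
        (Finset.card_image_le (s := F) (f := μ s(z, y)))
      intro b hb
      obtain ⟨f, hf, hfe, rfl⟩ := hex _ he b hb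
      exact Finset.mem_image.2 ⟨f, by simp only [F, Finset.mem_filter, Finset.mem_erase]; exact
        ⟨⟨hfe, hf⟩, hb⟩, rfl⟩
    have hFd : ∀ f ∈ F, ∀ w ∈ s(z, y), w ∉ f := fun f hf =>
      hdisj _ he f (hF f hf).1 (hF f hf).2.1 (hF f hf).2.2
    have hlt := card_lt_of_intersecting (F := F) (Finset.card_pos.1 (by omega))
      (Finset.univ \ {z, y, v}) (fun f hf => hQ f (hF f hf).1) ?_ ?_ ?_
    · rw [Finset.card_sdiff_of_subset (Finset.subset_univ _), Finset.card_univ,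
        Finset.card_eq_three.2 ⟨z, y, v, hzy, hzv, hyv, rfl⟩] at hlt
      omega
    · intro f hf w hw
      simp only [Finset.mem_sdiff, Finset.mem_univ, true_and, Finset.mem_insert,
        Finset.mem_singleton, not_or]
      refine ⟨?_, ?_, ?_⟩
      · rintro rfl; exact hFd f hf _ (Sym2.mem_mk_left _ _) hw
      · rintro rfl; exact hFd f hf _ (Sym2.mem_mk_right _ _) hw
      · rintro rfl
        exact hmeet _ he f (hF f hf).1 (hF f hf).2.1 (hF f hf).2.2 _ hk z hze hzk w hw
          (Sym2.mem_mk_right _ _)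
    · intro f hf f' hf'
      by_contra! hff
      exact hN3.not_ge (h.three_disjoint' hQ he (hF f hf).1 (hF f' hf').1 (hFd f hf) (hFd f' hf')
        hff)
    · intro a b c hab hac hbc
      have h1 := hFd _ hab
      have h2 := hFd _ hac
      have h3 := hQ _ (hF _ hab).1
      have h4 := hQ _ (hF _ hac).1
      have h5 := hQ _ (hF _ hbc).1
      exact hN3.not_ge (h.triangle_disjoint (by simp at *; grind) he (hF _ hab).1 (hF _ hac).1
        (hF _ hbc).1)
  obtain ⟨e, he, f, hf, k, hk, hef, hek, hfk⟩ := Finset.two_lt_card.1 (show 2 < Q.card by omega)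
  exact hN3.not_ge (h.three_disjoint' hQ he hf hk (hiso e he f hf hef.symm)
    (hiso e he k hk hek.symm) (hiso f hf k hk hfk.symm))

/-- Rich traces cover the non-edges of every connected graph on `V`. -/
theorem RichTraces.exists_cover (h : RichTraces B T) (hn : 4 ≤ Fintype.card V)
    {R₀ : SimpleGraph V} (hR : R₀.Connected) :
    ∃ c : β → Option V, (∀ b x, c b = some x → b ∈ B ∧ x ∈ T b) ∧
      ∀ x y, x ≠ y →
        R₀.Adj x y ∨ ∃ b, (c b = some x ∧ y ∈ T b) ∨ (c b = some y ∧ x ∈ T b) := by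
  classical
  let P : Finset (Sym2 V) := R₀ᶜ.edgeFinset
  have hP : ∀ x y, s(x, y) ∈ P ↔ x ≠ y ∧ ¬ R₀.Adj x y := fun x y => by
    simp only [P]
    rw [mem_edgeFinset, mem_edgeSet, compl_adj]
  suffices hg : P.Nonempty → ∃ g z, AssignsTraces B T P g z by
    rcases P.eq_empty_or_nonempty with hPe | hPne
    · refine ⟨fun _ => none, by simp, fun x y hxy => .inl ?_⟩
      by_contra hadj
      have := (hP x y).2 ⟨hxy, hadj⟩
      simp [hPe] at this
    · obtain ⟨g, z, hg⟩ := hg hPne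
      obtain ⟨c, hc, hc'⟩ := hg.exists_centers
      refine ⟨c, hc, fun x y hxy => ?_⟩
      by_cases hadj : R₀.Adj x y
      · exact .inl hadj
      · exact .inr (hc' x y ((hP x y).2 ⟨hxy, hadj⟩))
  intro hPne
  have hbound : ∀ Q ⊆ P, ∃ c j, c + j = Fintype.card V ∧ 2 ≤ c ∧
      2 * Q.card + 3 * j ≤ j * (2 * c + j) ∧
      (Fintype.card V - 3) * j ≤ (Q.biUnion (pairTraces B T)).card := fun Q hQ =>
    h.exists_bound (by omega) hR Q fun e he => mem_edgeFinset.1 (hQ he)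
  have hlarge : ∀ Q ⊆ P, Q.Nonempty →
      Fintype.card V - 3 ≤ (Q.biUnion (pairTraces B T)).card := by
    intro Q hQ hQne
    obtain ⟨c, j, hcj, hc, h1, h2⟩ := hbound Q hQ
    rcases Nat.eq_zero_or_pos j with rfl | hj
    · have := hQne.card_pos
      omega
    · exact (Nat.le_mul_of_pos_right _ hj).trans h2
  have hsmall : ∀ Q ⊆ P, Q.card ≤ (Q.biUnion (pairTraces B T)).card ∨
      (Q.card = (Q.biUnion (pairTraces B T)).card + 1 ∧
        (Q.card = Fintype.card V - 2 ∨ Q.card = 2 * Fintype.card V - 5)) := by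
    intro Q hQ
    obtain ⟨c, j, hcj, hc, h1, h2⟩ := hbound Q hQ
    obtain ⟨m, hm⟩ : ∃ m, Fintype.card V = m + 3 := ⟨Fintype.card V - 3, by omega⟩
    rw [hm] at hcj h2 ⊢
    rw [Nat.add_sub_cancel] at h2
    rcases Nat.lt_or_ge j 3 with hj | hj
    · interval_cases j <;> omega
    · left
      have : c + j = m + 3 := hcj
      nlinarith
  have hd : ∀ e ∈ P, ¬ e.IsDiag := fun e he => by
    induction e with
    | _ x y => exact ((hP x y).1 he).1
  have hβ : Nonempty β := by
    have := hlarge P subset_rfl hPne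
    obtain ⟨b, -⟩ := Finset.card_pos.1 (show 0 < (P.biUnion (pairTraces B T)).card by omega)
    exact ⟨b⟩
  by_cases hHall : ∀ s ⊆ P, s.card ≤ (s.biUnion (pairTraces B T)).card
  · obtain ⟨f, hf, hfN⟩ := exists_injOn_of_hall P _ hHall
    obtain ⟨z⟩ := hR.nonempty
    exact ⟨f, z, hfN, fun e he e' he' hee => .inl (hf he he' hee)⟩
  push Not at hHall
  obtain ⟨Q, hQ, hQmin⟩ := exists_minimalFor_of_wellFoundedLT
    (fun s : Finset (Sym2 V) => s ⊆ P ∧ (s.biUnion (pairTraces B T)).card < s.card)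
    Finset.card hHall
  have hQs := (hsmall Q hQ.1).resolve_left (not_le.2 hQ.2)
  obtain ⟨g, z, hg⟩ := h.exists_assignsTraces_of_tight hn (fun e he => hd e (hQ.1 he)) hQs.1
    (by
      intro s hs
      by_contra! hlt
      exact (Finset.card_lt_card hs).not_ge
        (hQmin ⟨hs.subset.trans hQ.1, hlt⟩ (Finset.card_le_card hs.subset)))
    (by
      intro e he
      simpa using hlarge {e} (by simpa using hQ.1 he) (by simp)) hQs.2
  obtain ⟨g', hg'⟩ := hg.extend hQ.1 hQ.2 fun s hs => by
    rcases hsmall s hs with h | h <;> omega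
  exact ⟨g', z, hg'⟩

end Cover

/-- A connected set retracts onto any nonempty subset `X` with connected fibres. -/
lemma ConnOn.exists_retraction {W : Type} [Finite W] {G : SimpleGraph W} {S X : Set W}
    (hS : ConnOn G S) (hXS : X ⊆ S) (hX : X.Nonempty) :
    ∃ ρ : W → W, (∀ x ∈ X, ρ x = x) ∧ (∀ s ∈ S, ρ s ∈ X) ∧
      ∀ s ∈ S, ReachIn G {u | u ∈ S ∧ ρ u = ρ s} s (ρ s) := by
  classical
  let P : Set W → Prop := fun D => X ⊆ D ∧ D ⊆ S ∧ ∃ ρ : W → W, (∀ x ∈ X, ρ x = x) ∧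
    (∀ s ∈ D, ρ s ∈ X) ∧ ∀ s ∈ D, ReachIn G {u | u ∈ D ∧ ρ u = ρ s} s (ρ s)
  have hPX : P X := ⟨subset_rfl, hXS, id, fun _ _ => rfl, fun _ h => h, fun _ _ => .refl⟩
  obtain ⟨D, hD, hmax⟩ := (Set.toFinite {D | P D}).exists_maximal ⟨X, hPX⟩
  obtain ⟨hXD, hDS, ρ, h1, h2, h3⟩ := hD
  suffices h : S ⊆ D by
    obtain rfl : D = S := hDS.antisymm h
    exact ⟨ρ, h1, h2, h3⟩
  intro s hs
  by_contra hsD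
  obtain ⟨x, hx⟩ := hX
  obtain ⟨u, hu, v, hv, -, hvS, huv⟩ := (hS x (hXS hx) s hs).exists_exit (hXD hx) hsD
  have hupd : ∀ w ∈ D, Function.update ρ v (ρ u) w = ρ w := fun w hw =>
    Function.update_of_ne (by rintro rfl; exact hv hw) _ _
  refine hv (hmax (y := insert v D) ⟨hXD.trans (Set.subset_insert _ _), Set.insert_subset hvS hDS,
    Function.update ρ v (ρ u), ?_, ?_, ?_⟩ (Set.subset_insert _ _) (Set.mem_insert _ _))
  · intro x hx
    rw [hupd x (hXD hx), h1 x hx]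
  · rintro s (rfl | hs)
    · simpa using h2 u hu
    · rw [hupd s hs]
      exact h2 s hs
  · have hold : ∀ s ∈ D, ReachIn G {w | w ∈ insert v D ∧ Function.update ρ v (ρ u) w = ρ s}
        s (ρ s) := fun s hs => (h3 s hs).mono le_rfl fun w hw => by
      refine ⟨Set.mem_insert_of_mem _ hw.1, ?_⟩
      rw [hupd w hw.1]
      exact hw.2
    rintro s (rfl | hs)
    · rw [Function.update_self]
      refine (ReachIn.single huv.symm ?_ ?_).trans (hold u hu)
      · simp
      · refine ⟨Set.mem_insert_of_mem _ hu, ?_⟩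
        rw [hupd u hu]
    · rw [hupd s hs]
      exact hold s hs

lemma IsMinorOf.of_card_eq {α β : Type} [Fintype β] {G : SimpleGraph α} {t : ℕ}
    (ht : Fintype.card β = t) (h : IsMinorOf (⊤ : SimpleGraph β) G) :
    IsMinorOf (⊤ : SimpleGraph (Fin t)) G := by
  obtain ⟨B, h1, h2, h3, h4⟩ := h
  let e := (Fintype.equivFinOfCardEq ht).symm
  refine ⟨B ∘ e, fun b => h1 _, fun b => h2 _, fun b b' hb => h3 (e.injective.ne hb), ?_⟩
  intro b b' hb
  exact h4 _ _ (by simpa using hb)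

section Merge

variable {W : Type} [DecidableEq W]

/-- Suppose every smaller configuration contradicts the absence of a `K_t`-minor.
Contracting the vertices of `X` along an idempotent map `rep`, using distinct
connectors from `A`, shows that many members of `A` see two identified vertices. -/
lemma lt_card_not_injOn_of_merge {t : ℕ} (ht : 2 ≤ t) {G : SimpleGraph W} [DecidableRel G.Adj]
    {S A X M : Finset W}
    (ih : ∀ (G' : SimpleGraph W) [DecidableRel G'.Adj] (S' A' : Finset W), S'.card < S.card →
      Disjoint S' A' → ConnOn G' S' → (∀ a ∈ A', t ≤ (S'.filter (G'.Adj a)).card) →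
      (t - 4) * S'.card < A'.card → IsMinorOf (⊤ : SimpleGraph (Fin t)) G')
    (hno : ¬ IsMinorOf (⊤ : SimpleGraph (Fin t)) G) (hSA : Disjoint S A) (hS : ConnOn G S)
    (hA : ∀ a ∈ A, t ≤ (S.filter (G.Adj a)).card) (hcard : (t - 4) * S.card < A.card)
    (hXS : X ⊆ S) {rep conn : W → W} (hrep : ∀ x ∈ X, rep x ∈ X)
    (hidem : ∀ x ∈ X, rep (rep x) = rep x) (hM : M = X.filter fun x => rep x ≠ x)
    (hMne : M.Nonempty) (hconn : Set.InjOn conn M)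
    (hconnA : ∀ y ∈ M, conn y ∈ A ∧ G.Adj (conn y) y ∧ G.Adj (conn y) (rep y)) :
    (t - 4) * M.card < (A.filter fun b => ¬ Set.InjOn rep (X.filter (G.Adj b))).card := by
  classical
  have hMX : ∀ y ∈ M, y ∈ X ∧ rep y ≠ y := fun y hy => by simpa [hM] using hy
  have hdisj : ∀ s ∈ S, s ∉ A := fun s hs => Finset.disjoint_left.1 hSA hs
  let q : W → W := fun w => if w ∈ X then rep w else
    if h : ∃ y ∈ M, conn y = w then rep h.choose else w
  have qX : ∀ w ∈ X, q w = rep w := fun w hw => by simp [q, hw]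
  have qconn : ∀ y ∈ M, q (conn y) = rep y := by
    intro y hy
    have hnX : conn y ∉ X := fun h => hdisj _ (hXS h) (hconnA y hy).1
    have hex : ∃ z ∈ M, conn z = conn y := ⟨y, hy, rfl⟩
    have := hconn hex.choose_spec.1 hy hex.choose_spec.2
    simp only [q, hnX, if_false, hex, dite_true, this]
  have qelse : ∀ w, w ∉ X → (∀ y ∈ M, conn y ≠ w) → q w = w := by
    intro w hw hw'
    have : ¬ ∃ y ∈ M, conn y = w := by simpa using hw'
    simp only [q, hw, if_false, this, dite_false]
  have qS : ∀ s ∈ S, s ∉ X → q s = s := fun s hs hsX =>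
    qelse s hsX fun y hy h => hdisj s hs (h ▸ (hconnA y hy).1)
  have qrep : ∀ x ∈ X, q (rep x) = rep x := fun x hx => by rw [qX _ (hrep x hx), hidem x hx]
  have hfib : ∀ w, ConnOn G (q ⁻¹' {w}) := by
    intro w
    refine connOn_of_root w ?_
    have hin : ∀ y ∈ X, rep y = w → ReachIn G (q ⁻¹' {w}) y w ∧
        (y ∈ M → ReachIn G (q ⁻¹' {w}) (conn y) w) := by
      rintro y hy rfl
      have h0 : rep y ∈ q ⁻¹' {rep y} := qrep y hy
      have hc : y ∈ M → ReachIn G (q ⁻¹' {rep y}) (conn y) (rep y) := fun hyM =>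
        .single (hconnA y hyM).2.2 (qconn y hyM) h0
      refine ⟨?_, hc⟩
      by_cases hyr : rep y = y
      · rw [hyr]; exact .refl
      · have hyM : y ∈ M := by simp [hM, hy, hyr]
        exact (ReachIn.single (hconnA y hyM).2.1.symm (qX y hy) (qconn y hyM)).trans (hc hyM)
    intro u hu
    have hu : q u = w := hu
    by_cases huX : u ∈ X
    · exact (hin u huX (by rw [← qX u huX, hu])).1
    by_cases huc : ∃ y ∈ M, conn y = u
    · obtain ⟨y, hy, rfl⟩ := huc
      exact (hin y (hMX y hy).1 (by rw [← qconn y hy, hu])).2 hy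
    · push Not at huc
      rw [qelse u huX huc] at hu
      rw [hu]
      exact .refl
  have hno' : ¬ IsMinorOf (⊤ : SimpleGraph (Fin t)) (quotientGraph G q) :=
    fun h => hno (h.of_quotientGraph ht hfib)
  have hMS : M ⊆ S := fun y hy => hXS (hMX y hy).1
  have qmem : ∀ s ∈ S, q s ∈ S \ M := by
    intro s hs
    rw [Finset.mem_sdiff]
    by_cases hsX : s ∈ X
    · rw [qX s hsX]
      refine ⟨hXS (hrep s hsX), fun h => (hMX _ h).2 (hidem s hsX)⟩
    · rw [qS s hs hsX]
      exact ⟨hs, fun h => hsX (hMX s h).1⟩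
  have qfix : ∀ s ∈ S \ M, q s = s := by
    intro s hs
    obtain ⟨hs, hsM⟩ := Finset.mem_sdiff.1 hs
    by_cases hsX : s ∈ X
    · rw [qX s hsX]
      by_contra h
      exact hsM (by simp [hM, hsX, h])
    · exact qS s hs hsX
  let A' := A.filter fun b => Set.InjOn rep (X.filter (G.Adj b))
  have hcardS : (S \ M).card + M.card = S.card := Finset.card_sdiff_add_card_eq_card hMS
  have hMpos := hMne.card_pos
  have hA' : A'.card ≤ (t - 4) * (S \ M).card := by
    by_contra! hlt
    refine hno' (ih _ (S \ M) A' (by omega) ?_ ?_ ?_ hlt)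
    · exact hSA.mono Finset.sdiff_subset (Finset.filter_subset _ _)
    · intro x hx y hy
      have hx' : x ∈ S \ M := by simpa using hx
      have hy' : y ∈ S \ M := by simpa using hy
      have := (hS x (Finset.mem_sdiff.1 hx').1 y (Finset.mem_sdiff.1 hy').1).lift
        (G' := quotientGraph G q) (K' := ((S \ M : Finset W) : Set W)) q (by
          intro u hu v hv huv
          by_cases huv' : q u = q v
          · rw [huv']; exact .refl
          · exact .single (quotientGraph_adj huv huv') (Finset.mem_coe.2 (qmem u hu))
              (Finset.mem_coe.2 (qmem v hv)))
      rwa [qfix x hx', qfix y hy'] at this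
    · intro a ha
      obtain ⟨haA, hinj⟩ := Finset.mem_filter.1 ha
      refine (hA a haA).trans (Finset.card_le_card_of_injOn q ?_ ?_)
      · intro s hs
        obtain ⟨hs, has⟩ := Finset.mem_filter.1 (Finset.mem_coe.1 hs)
        have haX : a ∉ X := fun h => hdisj a (hXS h) haA
        have hqa : q a = a := by
          refine qelse a haX fun y hy hya => (hMX y hy).2 ?_
          obtain ⟨-, h1, h2⟩ := hconnA y hy
          rw [hya] at h1 h2
          exact hinj (by simp [hrep y (hMX y hy).1, h2]) (by simp [(hMX y hy).1, h1])
            (hidem y (hMX y hy).1)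
        have hne : q a ≠ q s := fun h =>
          hdisj _ (Finset.mem_sdiff.1 (qmem s hs)).1 (by rw [← h, hqa]; exact haA)
        have := quotientGraph_adj has hne
        rw [hqa] at this
        exact Finset.mem_coe.2 (Finset.mem_filter.2 ⟨qmem s hs, this⟩)
      · intro u hu v hv huv
        obtain ⟨hu, hau⟩ := Finset.mem_filter.1 (Finset.mem_coe.1 hu)
        obtain ⟨hv, hav⟩ := Finset.mem_filter.1 (Finset.mem_coe.1 hv)
        by_cases huX : u ∈ X <;> by_cases hvX : v ∈ X
        · rw [qX u huX, qX v hvX] at huv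
          exact hinj (by simp [huX, hau]) (by simp [hvX, hav]) huv
        · rw [qX u huX, qS v hv hvX] at huv
          exact absurd (huv ▸ hrep u huX) hvX
        · rw [qS u hu huX, qX v hvX] at huv
          exact absurd (huv ▸ hrep v hvX) huX
        · rwa [qS u hu huX, qS v hv hvX] at huv
  have hsum := Finset.card_filter_add_card_filter_not (s := A)
    (fun b => Set.InjOn rep (X.filter (G.Adj b)))
  have hexp : (t - 4) * S.card = (t - 4) * (S \ M).card + (t - 4) * M.card := by
    rw [← hcardS, mul_add]
  change A'.card + _ = _ at hsum
  omega

end Merge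

section Dense

variable {W : Type} [DecidableEq W]

/-- If the traces `N(b) ∩ X` of the members `b` of `B` are rich, then a connected set `S ⊇ X`
together with a further vertex complete to `X` yields a clique minor on `#X + 1` vertices. -/
lemma IsMinorOf.of_richTraces [Finite W] {t : ℕ} (ht : 5 ≤ t) {G : SimpleGraph W}
    [DecidableRel G.Adj] {S X B : Finset W} {a : W} (hS : ConnOn G S) (hXS : X ⊆ S)
    (haS : a ∉ S) (haB : a ∉ B) (hSB : Disjoint S B) (hX : X.card = t - 1)
    (haX : ∀ x ∈ X, G.Adj a x)
    (hrich : RichTraces (V := X) B fun b => Finset.univ.filter fun x => G.Adj b x) :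
    IsMinorOf (⊤ : SimpleGraph (Fin t)) G := by
  have hXne : X.Nonempty := Finset.card_pos.1 (by omega)
  obtain ⟨ρ, hρX, hρS, hρ⟩ := hS.exists_retraction (X := X) (by exact_mod_cast hXS)
    (by exact_mod_cast hXne)
  let f : ↥(S : Set W) → X := fun s => ⟨ρ s, by simpa using hρS s s.2⟩
  have hR : (quotientGraph (G.induce (S : Set W)) f).Connected := by
    have : Nonempty X := hXne.to_subtype
    refine ⟨?_⟩
    rw [← connOn_univ_iff]
    intro x _ y _
    have hpre := (connOn_univ_iff.2 (connOn_iff_induce_preconnected.1 hS))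
    have := (hpre ⟨x, hXS x.2⟩ trivial ⟨y, hXS y.2⟩ trivial).lift
      (G' := quotientGraph (G.induce (S : Set W)) f) (K' := Set.univ) f (by
        intro u _ v _ huv
        by_cases h : f u = f v
        · rw [h]; exact .refl
        · exact .single (quotientGraph_adj huv h) trivial trivial)
    convert this using 1
    · exact Subtype.ext (hρX x x.2).symm
    · exact Subtype.ext (hρX y y.2).symm
  obtain ⟨c, hc, hcov⟩ := hrich.exists_cover (by simp [hX]; omega) hR
  have hc' : ∀ b x, c b = some x → b ∈ B ∧ G.Adj b x := fun b x h => by simpa using hc b x h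
  let Br : Option X → Set W := fun o => o.elim {a} fun x =>
    {s | s ∈ S ∧ ρ s = x} ∪ {b | c b = some x}
  have hroot : ∀ x : X, (x : W) ∈ Br (some x) := fun x => Or.inl ⟨hXS x.2, hρX x x.2⟩
  have hne : ∀ o, (Br o).Nonempty := by
    rintro (_ | x)
    · exact ⟨a, rfl⟩
    · exact ⟨x, hroot x⟩
  refine IsMinorOf.of_card_eq (β := Option X) (by simp [hX]; omega)
    ⟨Br, hne, fun o => ConnOn.induce_connected ?_ (hne o), ?_, ?_⟩
  · rcases o with _ | x
    · exact connOn_singleton G a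
    refine connOn_of_root (x : W) ?_
    rintro s (⟨hs, hsx⟩ | hs)
    · rw [← hsx]
      refine (hρ s hs).mono le_rfl fun u hu => Or.inl ⟨hu.1, hu.2.trans hsx⟩
    · exact .single (hc' s x hs).2 (Or.inr hs) (hroot x)
  · have hdis : ∀ x : X, Disjoint {a} (Br (some x)) := by
      intro x
      rw [Set.disjoint_singleton_left]
      rintro (⟨h, -⟩ | h)
      · exact haS h
      · exact haB (hc' _ _ h).1
    rintro (_ | x) (_ | y) hxy
    · exact absurd rfl hxy
    · exact hdis y
    · exact (hdis x).symm
    · refine Set.disjoint_left.2 ?_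
      have hxy' : x ≠ y := fun h => hxy (congrArg some h)
      rintro s (⟨h1, h2⟩ | h1) (⟨h3, h4⟩ | h3)
      · exact hxy' (Subtype.ext (h2.symm.trans h4))
      · exact Finset.disjoint_left.1 hSB h1 (hc' _ _ h3).1
      · exact Finset.disjoint_left.1 hSB h3 (hc' _ _ h1).1
      · exact hxy' (Option.some.inj ((Eq.symm h1).trans h3))
  · rintro (_ | x) (_ | y) hxy
    · exact absurd hxy (by simp)
    · exact ⟨a, rfl, y, hroot y, haX y y.2⟩
    · exact ⟨x, hroot x, a, rfl, (haX x x.2).symm⟩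
    · have hxy' : x ≠ y := by simpa using hxy
      obtain ⟨-, s, s', hsx, hsy, hss⟩ | ⟨b, ⟨hb, hby⟩ | ⟨hb, hbx⟩⟩ := hcov x y hxy'
      · exact ⟨s, Or.inl ⟨s.2, congrArg Subtype.val hsx⟩, s',
          Or.inl ⟨s'.2, congrArg Subtype.val hsy⟩, hss⟩
      · exact ⟨b, Or.inr hb, y, hroot y, by simpa using hby⟩
      · exact ⟨x, hroot x, b, Or.inr hb, (by simpa using hbx : G.Adj b x).symm⟩

/-- Vertices outside `S`, each with at least `t` neighbours in the connected set `S`, give a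
`K_t`-minor as soon as there are more than `(t - 4) * #S` of them. -/
theorem IsMinorOf.of_many_attachments [Finite W] {t : ℕ} (ht : 5 ≤ t) (G : SimpleGraph W)
    [DecidableRel G.Adj] (S A : Finset W) (hSA : Disjoint S A) (hS : ConnOn G S)
    (hA : ∀ a ∈ A, t ≤ (S.filter (G.Adj a)).card) (hcard : (t - 4) * S.card < A.card) :
    IsMinorOf (⊤ : SimpleGraph (Fin t)) G := by
  induction hk : S.card using Nat.strong_induction_on generalizing G S A with
  | _ k IH =>
  subst hk
  by_contra hno
  have ih : ∀ (G' : SimpleGraph W) [DecidableRel G'.Adj] (S' A' : Finset W), S'.card < S.card →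
      Disjoint S' A' → ConnOn G' S' → (∀ a ∈ A', t ≤ (S'.filter (G'.Adj a)).card) →
      (t - 4) * S'.card < A'.card → IsMinorOf (⊤ : SimpleGraph (Fin t)) G' :=
    fun G' _ S' A' h h1 h2 h3 h4 => IH _ h G' S' A' h1 h2 h3 h4 rfl
  obtain ⟨a, ha⟩ : A.Nonempty := Finset.card_pos.1 (by omega)
  obtain ⟨X, hXN, hX⟩ := Finset.exists_subset_card_eq ((Nat.sub_le t 1).trans (hA a ha))
  have hXS : X ⊆ S := hXN.trans (Finset.filter_subset _ _)
  have haX : ∀ x ∈ X, G.Adj a x := fun x hx => (Finset.mem_filter.1 (hXN hx)).2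
  have hpair : ∀ x ∈ X, ∀ y ∈ X, x ≠ y →
      t - 4 < (A.filter fun b => G.Adj b y ∧ G.Adj b x).card := by
    intro x hx y hy hxy
    have := lt_card_not_injOn_of_merge (by omega) ih hno hSA hS hA hcard hXS (M := {y})
      (rep := fun w => if w = y then x else w) (conn := fun _ => a)
      (fun w hw => by split_ifs <;> assumption)
      (fun w _ => by split_ifs <;> simp_all)
      (by ext w; by_cases h : w = y <;> simp_all) (Finset.singleton_nonempty y)
      (by simp) (by simpa using ⟨ha, haX y hy, haX x hx⟩)
    rw [Finset.card_singleton, mul_one] at this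
    refine this.trans_le (Finset.card_le_card fun b hb => ?_)
    obtain ⟨hbA, hb⟩ := Finset.mem_filter.1 hb
    refine Finset.mem_filter.2 ⟨hbA, ?_⟩
    simp only [Set.InjOn, not_forall, Finset.mem_coe, Finset.mem_filter] at hb
    obtain ⟨u, ⟨-, hu⟩, v, ⟨-, hv⟩, huv, hne⟩ := hb
    split_ifs at huv <;> simp_all
  refine hno (.of_richTraces ht hS hXS (a := a) (B := A.erase a)
    (fun h => Finset.disjoint_left.1 hSA h ha) (Finset.notMem_erase a A)
    (hSA.mono_right (Finset.erase_subset a A)) hX haX fun p hp => ?_)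
  have : Nonempty X := (Finset.card_pos.1 (by omega : 0 < X.card)).to_subtype
  let r : X → X := fun x => Function.invFun p (p x)
  have hpr : ∀ x, p (r x) = p x := fun x => Function.invFun_eq ⟨x, rfl⟩
  have hrr : ∀ x, r (r x) = r x := fun x => by simp only [r]; rw [hpr]
  let M' : Finset X := Finset.univ.filter fun x => r x ≠ x
  have hM' : M'.card = t - 1 - (Finset.univ.image p).card := by
    have h1 := Finset.card_filter_add_card_filter_not (s := (Finset.univ : Finset X))
      (fun x => r x = x)
    have h2 : (Finset.univ.filter fun x => r x = x).card = (Finset.univ.image p).card := by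
      refine Finset.card_bij (fun x _ => p x) (fun x _ => by simp) ?_ ?_
      · intro x hx y hy hxy
        rw [← (Finset.mem_filter.1 hx).2, ← (Finset.mem_filter.1 hy).2]
        simp only [r, hxy]
      · intro y hy
        obtain ⟨x, -, rfl⟩ := Finset.mem_image.1 hy
        exact ⟨r x, by simp [hrr], hpr x⟩
    have h3 : (Finset.univ : Finset X).card = t - 1 := by simp [hX]
    have h4 : (Finset.univ.filter fun x => ¬ r x = x).card = M'.card := rfl
    omega
  have hcX : Fintype.card X = t - 1 := by simp [hX]
  rw [hcX, ← hM', show t - 1 - 3 = t - 4 by omega]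
  rcases M'.eq_empty_or_nonempty with hM0 | hMne
  · simp [hM0]
  let rep : W → W := fun w => if h : w ∈ X then r ⟨w, h⟩ else w
  have hrep : ∀ x : X, rep x = r x := fun x => by simp [rep]
  let M : Finset W := X.filter fun x => rep x ≠ x
  have hMM : M = M'.map (Function.Embedding.subtype _) := by
    ext w
    simp only [M, M', Finset.mem_filter, Finset.mem_map, Finset.mem_univ, true_and,
      Function.Embedding.subtype_apply]
    constructor
    · rintro ⟨hw, h⟩
      exact ⟨⟨w, hw⟩, fun h' => h (by rw [hrep ⟨w, hw⟩, h']), rfl⟩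
    · rintro ⟨x, hx, rfl⟩
      exact ⟨x.2, fun h => hx (Subtype.ext (by rw [← hrep, h]))⟩
  have hMcard : M.card = M'.card := by rw [hMM, Finset.card_map]
  have hrepX : ∀ x ∈ X, rep x ∈ X := fun x hx => by rw [hrep ⟨x, hx⟩]; exact (r _).2
  have : Nonempty W := ⟨a⟩
  obtain ⟨conn, hinj, hconn⟩ := exists_injOn_of_hall M
    (fun y => A.filter fun b => G.Adj b y ∧ G.Adj b (rep y)) (by
      intro s hs
      rcases s.eq_empty_or_nonempty with rfl | ⟨y, hy⟩
      · simp
      obtain ⟨hyX, hy'⟩ := Finset.mem_filter.1 (hs hy)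
      have h1 := hpair (rep y) (hrepX y hyX) y hyX hy'
      have h2 := Finset.card_le_card (Finset.subset_biUnion_of_mem
        (fun y => A.filter fun b => G.Adj b y ∧ G.Adj b (rep y)) hy)
      have h3 := Finset.card_le_card hs
      omega)
  have key := lt_card_not_injOn_of_merge (by omega) ih hno hSA hS hA hcard hXS (M := M)
    (rep := rep) (conn := conn) hrepX
    (fun x hx => by rw [hrep ⟨x, hx⟩, hrep, hrr]) rfl
    (by rw [hMM]; exact hMne.map) hinj
    (fun y hy => by simpa using hconn y hy)
  rw [hMcard] at key
  refine Nat.le_of_lt_succ (key.trans_le ?_)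
  rw [Nat.succ_eq_add_one]
  refine le_trans (Finset.card_le_card (fun b hb => ?_)) (Finset.card_insert_le a _)
  obtain ⟨hbA, hb⟩ := Finset.mem_filter.1 hb
  rw [Finset.mem_insert, Finset.mem_filter, Finset.mem_erase]
  by_cases hba : b = a
  · exact .inl hba
  refine .inr ⟨⟨hba, hbA⟩, fun hp' => hb fun u hu v hv huv => ?_⟩
  obtain ⟨huX, hbu⟩ := Finset.mem_filter.1 (Finset.mem_coe.1 hu)
  obtain ⟨hvX, hbv⟩ := Finset.mem_filter.1 (Finset.mem_coe.1 hv)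
  rw [hrep ⟨u, huX⟩, hrep ⟨v, hvX⟩] at huv
  have : (⟨u, huX⟩ : X) = ⟨v, hvX⟩ := hp' (by simpa using hbu) (by simpa using hbv) (by
    rw [← hpr ⟨u, huX⟩, Subtype.ext huv, hpr])
  exact congrArg Subtype.val this

end Dense

lemma ConnOn.union {V : Type} {G : SimpleGraph V} {K L : Set V} (hK : ConnOn G K)
    (hL : ConnOn G L) {z : V} (hzK : z ∈ K) (hzL : z ∈ L) : ConnOn G (K ∪ L) := by
  refine connOn_of_root z ?_
  rintro x (hx | hx)
  · exact (hK x hx z hzK).mono le_rfl Set.subset_union_left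
  · exact (hL x hx z hzL).mono le_rfl Set.subset_union_right

lemma ReachIn.of_walk {V : Type} {G G' : SimpleGraph V} {K : Set V} {a b : V} (q : G.Walk a b)
    (h : ∀ u v, s(u, v) ∈ q.edges → ReachIn G' K u v) : ReachIn G' K a b := by
  induction q with
  | nil => exact .refl
  | cons hadj q ih =>
    refine (h _ _ (by simp)).trans (ih fun u v huv => h u v ?_)
    rw [Walk.edges_cons]
    exact List.mem_cons_of_mem _ huv

lemma SimpleGraph.Walk.connOn_support {V : Type} {G : SimpleGraph V} {a b : V}
    (q : G.Walk a b) : ConnOn G {v | v ∈ q.support} := by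
  classical
  refine connOn_of_root b fun x hx => ReachIn.of_walk (q.dropUntil x hx) fun u v huv => ?_
  have hq : s(u, v) ∈ q.edges := q.edges_dropUntil_subset_edges hx huv
  exact .single (q.adj_of_mem_edges hq) (q.fst_mem_support_of_mem_edges hq)
    (q.snd_mem_support_of_mem_edges hq)

/-- The graphs `G` and `G'` have the same edges not contained in `K`. -/
def AgreeOff {V : Type} (K : Set V) (G G' : SimpleGraph V) : Prop :=
  ∀ u v, ¬ (u ∈ K ∧ v ∈ K) → (G'.Adj u v ↔ G.Adj u v)

namespace AgreeOff

variable {V : Type} {K L : Set V} {G G' : SimpleGraph V}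

lemma mono (h : AgreeOff K G G') (hKL : K ⊆ L) : AgreeOff L G G' :=
  fun u v huv => h u v fun huv' => huv ⟨hKL huv'.1, hKL huv'.2⟩

lemma neighborSet_eq (h : AgreeOff K G G') {v : V} (hv : v ∉ K) :
    G'.neighborSet v = G.neighborSet v :=
  Set.ext fun u => h v u fun h' => hv h'.1

lemma connOn (h : AgreeOff K G G') (hK : ConnOn G' K) (hKL : K ⊆ L) (hL : ConnOn G L) :
    ConnOn G' L := fun x hx y hy => (hL x hx y hy).of_forall fun u hu v hv huv => by
  by_cases hK' : u ∈ K ∧ v ∈ K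
  · exact (hK u hK'.1 v hK'.2).mono le_rfl hKL
  · exact .single ((h u v hK').2 huv) hu hv

end AgreeOff

section Witness

variable {V : Type}

/-- `K` is a `T`-connected set of vertices of degree at most `k` in which the degree of any
single vertex can be pushed below `k` by rerouting `T` inside `K`. -/
def Relaxable (H T : SimpleGraph V) (k : ℕ) (K : Set V) : Prop :=
  (∀ u ∈ K, (T.neighborSet u).ncard ≤ k) ∧ ConnOn T K ∧
    ∀ w ∈ K, ∃ T' ≤ H, AgreeOff K T T' ∧ ConnOn T' K ∧
      (∀ u ∈ K, (T'.neighborSet u).ncard ≤ k) ∧ (T'.neighborSet w).ncard < k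

variable {H T : SimpleGraph V} {k : ℕ} {K K₁ K₂ L : Set V}

lemma relaxable_singleton (hT : T ≤ H) {v : V} (hv : (T.neighborSet v).ncard < k) :
    Relaxable H T k {v} := by
  refine ⟨by simpa using hv.le, connOn_singleton T v, fun w hw => ?_⟩
  obtain rfl : w = v := hw
  exact ⟨T, hT, fun _ _ _ => Iff.rfl, connOn_singleton T w, by simpa using hv.le, hv⟩

lemma Relaxable.exists_relax (hK : Relaxable H T k K) (hKL : K ⊆ L) (hL : ConnOn T L)
    (hdeg : ∀ u ∈ L, (T.neighborSet u).ncard ≤ k) {w : V} (hw : w ∈ K) :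
    ∃ T' ≤ H, AgreeOff L T T' ∧ ConnOn T' L ∧
      (∀ u ∈ L, (T'.neighborSet u).ncard ≤ k) ∧ (T'.neighborSet w).ncard < k := by
  obtain ⟨T', hT', hag, hconn, hd, hdw⟩ := hK.2.2 w hw
  refine ⟨T', hT', hag.mono hKL, hag.connOn hconn hKL hL, fun u hu => ?_, hdw⟩
  by_cases huK : u ∈ K
  · exact hd u huK
  · rw [hag.neighborSet_eq huK]
    exact hdeg u hu

lemma Relaxable.union (h₁ : Relaxable H T k K₁) (h₂ : Relaxable H T k K₂) {z : V}
    (hz₁ : z ∈ K₁) (hz₂ : z ∈ K₂) : Relaxable H T k (K₁ ∪ K₂) := by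
  have hconn := h₁.2.1.union h₂.2.1 hz₁ hz₂
  have hdeg : ∀ u ∈ K₁ ∪ K₂, (T.neighborSet u).ncard ≤ k := by
    rintro u (hu | hu)
    · exact h₁.1 u hu
    · exact h₂.1 u hu
  refine ⟨hdeg, hconn, ?_⟩
  rintro w (hw | hw)
  · exact h₁.exists_relax Set.subset_union_left hconn hdeg hw
  · exact h₂.exists_relax Set.subset_union_right hconn hdeg hw

/-- An edge `xy` between disjoint relaxable sets can be exchanged against a tree edge at an
interior vertex `w` of the tree path from `x` to `y`. -/
lemma Relaxable.exists_exchange [Finite V] (hT : T ≤ H) (h₁ : Relaxable H T k K₁)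
    (h₂ : Relaxable H T k K₂) (hdis : Disjoint K₁ K₂) {x y : V} (hx : x ∈ K₁) (hy : y ∈ K₂)
    (hxy : H.Adj x y) {p : T.Walk x y} (hp : p.IsPath) {w : V} (hw : w ∈ p.support)
    (hw₁ : w ∉ K₁) (hw₂ : w ∉ K₂) :
    ∃ T' ≤ H, (∀ L, K₁ ⊆ L → K₂ ⊆ L → {v | v ∈ p.support} ⊆ L →
        AgreeOff L T T' ∧ (ConnOn T L → ConnOn T' L)) ∧
      (∀ u ∈ K₁ ∪ K₂, (T'.neighborSet u).ncard ≤ k) ∧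
      (∀ u ∉ K₁ ∪ K₂, (T'.neighborSet u).ncard ≤ (T.neighborSet u).ncard) ∧
      (T'.neighborSet w).ncard < (T.neighborSet w).ncard := by
  obtain ⟨T₁, hT₁, hag₁, hc₁, hd₁, hdx⟩ := h₁.2.2 x hx
  obtain ⟨T₂, hT₂, hag₂, hc₂, hd₂, hdy⟩ := h₂.2.2 y hy
  obtain ⟨p₁, p₂, rfl⟩ := Walk.mem_support_iff_exists_append.1 hw
  cases p₂ with
  | nil => exact absurd hy hw₂
  | @cons _ w' _ hww' p₂ =>
  have htrail := hp.isTrail.edges_nodup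
  rw [Walk.edges_append, Walk.edges_cons, List.nodup_append] at htrail
  obtain ⟨-, hnd, hnd'⟩ := htrail
  have hp₁ : s(w, w') ∉ p₁.edges := fun h => hnd' _ h _ (by simp) rfl
  have hp₂ : s(w, w') ∉ p₂.edges := (List.nodup_cons.1 hnd).1
  have hd12 : ∀ u ∈ K₁, u ∉ K₂ := fun u h h' => Set.disjoint_left.1 hdis h h'
  have hxy₁ : x ≠ y := fun h => hd12 x hx (h ▸ hy)
  let R : V → V → Prop := fun u v =>
    ((u ∈ K₁ ∧ v ∈ K₁) ∧ T₁.Adj u v) ∨ ((u ∈ K₂ ∧ v ∈ K₂) ∧ T₂.Adj u v) ∨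
    (¬ (u ∈ K₁ ∧ v ∈ K₁) ∧ ¬ (u ∈ K₂ ∧ v ∈ K₂) ∧ T.Adj u v ∧ s(u, v) ≠ s(w, w')) ∨
    s(u, v) = s(x, y)
  have hRs : ∀ u v, R u v → R v u := by
    rintro u v (⟨h, h'⟩ | ⟨h, h'⟩ | ⟨h₁, h₂, h, h'⟩ | h)
    · exact .inl ⟨h.symm, h'.symm⟩
    · exact .inr (.inl ⟨h.symm, h'.symm⟩)
    · refine .inr (.inr (.inl ⟨fun h => h₁ h.symm, fun h => h₂ h.symm, h.symm, ?_⟩))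
      rwa [Sym2.eq_swap]
    · exact .inr (.inr (.inr (Sym2.eq_swap.trans h)))
  have hRH : ∀ u v, R u v → H.Adj u v := by
    rintro u v (⟨-, h⟩ | ⟨-, h⟩ | ⟨-, -, h, -⟩ | h)
    · exact hT₁ h
    · exact hT₂ h
    · exact hT h
    · rw [← mem_edgeSet, h]
      exact hxy
  let T' : SimpleGraph V := ⟨R, ⟨hRs⟩, ⟨fun u h => (hRH u u h).ne rfl⟩⟩
  have hn₁ : ∀ u ∈ K₁, u ≠ x → T'.neighborSet u ⊆ T₁.neighborSet u := by
    rintro u hu hux v (⟨-, h⟩ | ⟨h, -⟩ | ⟨h, -, h', -⟩ | h)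
    · exact h
    · exact absurd h.1 (hd12 u hu)
    · exact (hag₁ u v h).2 h'
    · obtain ⟨rfl, rfl⟩ | ⟨rfl, rfl⟩ := Sym2.eq_iff.1 h
      · exact absurd rfl hux
      · exact absurd hy (hd12 _ hu)
  have hn₂ : ∀ u ∈ K₂, u ≠ y → T'.neighborSet u ⊆ T₂.neighborSet u := by
    rintro u hu huy v (⟨h, -⟩ | ⟨-, h⟩ | ⟨-, h, h', -⟩ | h)
    · exact absurd hu (hd12 u h.1)
    · exact h
    · exact (hag₂ u v h).2 h'
    · obtain ⟨rfl, rfl⟩ | ⟨rfl, rfl⟩ := Sym2.eq_iff.1 h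
      · exact absurd hu (hd12 _ hx)
      · exact absurd rfl huy
  have hnx : T'.neighborSet x ⊆ insert y (T₁.neighborSet x) := by
    rintro v (⟨-, h⟩ | ⟨h, -⟩ | ⟨h, -, h', -⟩ | h)
    · exact .inr h
    · exact absurd h.1 (hd12 x hx)
    · exact .inr ((hag₁ x v h).2 h')
    · obtain ⟨-, rfl⟩ | ⟨h, -⟩ := Sym2.eq_iff.1 h
      · exact .inl rfl
      · exact absurd h hxy₁
  have hny : T'.neighborSet y ⊆ insert x (T₂.neighborSet y) := by
    rintro v (⟨h, -⟩ | ⟨-, h⟩ | ⟨-, h, h', -⟩ | h)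
    · exact absurd hy (hd12 y h.1)
    · exact .inr h
    · exact .inr ((hag₂ y v h).2 h')
    · obtain ⟨h, -⟩ | ⟨-, rfl⟩ := Sym2.eq_iff.1 h
      · exact absurd h.symm hxy₁
      · exact .inl rfl
  have hn : ∀ u, u ∉ K₁ → u ∉ K₂ → ∀ v, T'.Adj u v → T.Adj u v ∧ s(u, v) ≠ s(w, w') := by
    rintro u hu₁ hu₂ v (⟨h, -⟩ | ⟨h, -⟩ | ⟨-, -, h⟩ | h)
    · exact absurd h.1 hu₁
    · exact absurd h.1 hu₂
    · exact h
    · obtain ⟨rfl, rfl⟩ | ⟨rfl, rfl⟩ := Sym2.eq_iff.1 h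
      · exact absurd hx hu₁
      · exact absurd hy hu₂
  refine ⟨T', fun u v h => hRH u v h, fun L hL₁ hL₂ hL => ⟨?_, fun hTL => ?_⟩, ?_, ?_, ?_⟩
  · intro u v huv
    have hK₁ : ¬ (u ∈ K₁ ∧ v ∈ K₁) := fun h => huv ⟨hL₁ h.1, hL₁ h.2⟩
    have hK₂ : ¬ (u ∈ K₂ ∧ v ∈ K₂) := fun h => huv ⟨hL₂ h.1, hL₂ h.2⟩
    constructor
    · rintro (⟨h, -⟩ | ⟨h, -⟩ | ⟨-, -, h, -⟩ | h)
      · exact absurd h hK₁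
      · exact absurd h hK₂
      · exact h
      · obtain ⟨rfl, rfl⟩ | ⟨rfl, rfl⟩ := Sym2.eq_iff.1 h
        · exact absurd ⟨hL₁ hx, hL₂ hy⟩ huv
        · exact absurd ⟨hL₂ hy, hL₁ hx⟩ huv
    · intro h
      refine .inr (.inr (.inl ⟨hK₁, hK₂, h, fun h' => huv ?_⟩))
      have hwL : w ∈ L := hL hw
      have hwL' : w' ∈ L := hL (by simp)
      obtain ⟨rfl, rfl⟩ | ⟨rfl, rfl⟩ := Sym2.eq_iff.1 h'
      · exact ⟨hwL, hwL'⟩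
      · exact ⟨hwL', hwL⟩
  · have hedge : ∀ u ∈ L, ∀ v ∈ L, T.Adj u v → s(u, v) ≠ s(w, w') → ReachIn T' L u v := by
      intro u hu v hv huv hne
      by_cases hu₁ : u ∈ K₁ ∧ v ∈ K₁
      · exact (hc₁ u hu₁.1 v hu₁.2).of_forall fun a ha b hb hab =>
          .single (.inl ⟨⟨ha, hb⟩, hab⟩) (hL₁ ha) (hL₁ hb)
      by_cases hu₂ : u ∈ K₂ ∧ v ∈ K₂
      · exact (hc₂ u hu₂.1 v hu₂.2).of_forall fun a ha b hb hab =>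
          .single (.inr (.inl ⟨⟨ha, hb⟩, hab⟩)) (hL₂ ha) (hL₂ hb)
      exact .single (.inr (.inr (.inl ⟨hu₁, hu₂, huv, hne⟩))) hu hv
    have hwalk : ∀ {a b : V} (q : T.Walk a b), s(w, w') ∉ q.edges →
        q.support ⊆ (p₁.append (.cons hww' p₂)).support → ReachIn T' L a b := by
      intro a b q hq hqs
      refine .of_walk q fun u v huv => hedge u ?_ v ?_ (q.adj_of_mem_edges huv) ?_
      · exact hL (hqs (q.fst_mem_support_of_mem_edges huv))
      · exact hL (hqs (q.snd_mem_support_of_mem_edges huv))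
      · rintro h
        exact hq (h ▸ huv)
    have hww : ReachIn T' L w w' := by
      refine ((hwalk p₁ hp₁ ?_).symm.trans (.single (y := y) ?_ (hL₁ hx) (hL₂ hy))).trans
        (hwalk p₂ hp₂ ?_).symm
      · exact Walk.support_subset_support_append_left _ _
      · exact .inr (.inr (.inr rfl))
      · intro z hz
        rw [Walk.mem_support_append_iff, Walk.support_cons]
        exact .inr (List.mem_cons_of_mem _ hz)
    refine fun a ha b hb => (hTL a ha b hb).of_forall fun u hu v hv huv => ?_
    by_cases hne : s(u, v) = s(w, w')
    · obtain ⟨rfl, rfl⟩ | ⟨rfl, rfl⟩ := Sym2.eq_iff.1 hne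
      · exact hww
      · exact hww.symm
    · exact hedge u hu v hv huv hne
  · rintro u (hu | hu)
    · by_cases hux : u = x
      · subst hux
        have h1 := Set.ncard_le_ncard hnx
        have h2 := Set.ncard_insert_le y (T₁.neighborSet u)
        omega
      · exact (Set.ncard_le_ncard (hn₁ u hu hux)).trans (hd₁ u hu)
    · by_cases huy : u = y
      · subst huy
        have h1 := Set.ncard_le_ncard hny
        have h2 := Set.ncard_insert_le x (T₂.neighborSet u)
        omega
      · exact (Set.ncard_le_ncard (hn₂ u hu huy)).trans (hd₂ u hu)
  · intro u hu
    rw [Set.mem_union, not_or] at hu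
    exact Set.ncard_le_ncard fun v hv => (hn u hu.1 hu.2 v hv).1
  · refine Set.ncard_lt_ncard ⟨fun v hv => (hn w hw₁ hw₂ v hv).1, fun h => ?_⟩
    exact (hn w hw₁ hw₂ w' (h hww')).2 rfl

/-- A connected graph has a spanning tree of maximum degree at most `k`, or a spanning tree with
a set `S` of vertices of degree at least `k` whose removal leaves no non-tree connections. -/
theorem exists_isTree_witness [Fintype V] (hH : H.Connected) (k : ℕ) :
    ∃ T ≤ H, T.IsTree ∧ ((∀ v, (T.neighborSet v).ncard ≤ k) ∨
      ∃ S : Set V, (∀ v ∈ S, k ≤ (T.neighborSet v).ncard) ∧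
        (∃ v ∈ S, k < (T.neighborSet v).ncard) ∧
        ∀ x ∉ S, ∀ y ∉ S, H.Adj x y → ReachIn T Sᶜ x y) := by
  classical
  let exc : SimpleGraph V → ℕ := fun T => ∑ v, ((T.neighborSet v).ncard - k)
  obtain ⟨T, ⟨hTH, hT⟩, hmin⟩ := (Set.toFinite {T | T ≤ H ∧ T.IsTree}).exists_minimalFor exc _
    hH.exists_isTree_le
  have hmin' : ∀ T' ≤ H, T'.Connected → exc T ≤ exc T' := by
    intro T' hT' hc
    obtain ⟨T'', h, ht⟩ := hc.exists_isTree_le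
    have hle : exc T'' ≤ exc T' := Finset.sum_le_sum fun v _ =>
      Nat.sub_le_sub_right (Set.ncard_le_ncard fun u hu => h hu) k
    by_contra! hlt
    have := hmin (j := T'') ⟨h.trans hT', ht⟩ (by omega)
    omega
  refine ⟨T, hTH, hT, ?_⟩
  by_cases hdeg : ∀ v, (T.neighborSet v).ncard ≤ k
  · exact .inl hdeg
  push Not at hdeg
  obtain ⟨v₀, hv₀⟩ := hdeg
  have hmeet : ∀ x y K₁ K₂, x ∈ K₁ → y ∈ K₂ → Relaxable H T k K₁ → Relaxable H T k K₂ →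
      H.Adj x y → ∃ K, Relaxable H T k K ∧ x ∈ K ∧ y ∈ K := by
    intro x y K₁ K₂ hx hy h₁ h₂ hxy
    by_cases hdis : Disjoint K₁ K₂
    · obtain ⟨p, hp⟩ := (hT.connected.preconnected x y).exists_isPath
      let L : Set V := (K₁ ∪ {v | v ∈ p.support}) ∪ K₂
      have hL₁ : K₁ ⊆ L := fun v hv => .inl (.inl hv)
      have hL₂ : K₂ ⊆ L := fun v hv => .inr hv
      have hLp : {v | v ∈ p.support} ⊆ L := fun v hv => .inl (.inr hv)
      have hL : ConnOn T L := (h₁.2.1.union p.connOn_support hx p.start_mem_support).union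
        h₂.2.1 (.inr p.end_mem_support) hy
      have hdeg : ∀ u ∈ L, (T.neighborSet u).ncard ≤ k := by
        intro w hw
        by_contra! hlt
        have hw₁ : w ∉ K₁ := fun h => hlt.not_ge (h₁.1 w h)
        have hw₂ : w ∉ K₂ := fun h => hlt.not_ge (h₂.1 w h)
        have hwp : w ∈ p.support := by
          rcases hw with (h | h) | h
          · exact absurd h hw₁
          · exact h
          · exact absurd h hw₂
        obtain ⟨T', hT', hconn, hd, hd', hdw⟩ :=
          h₁.exists_exchange hTH h₂ hdis hx hy hxy hp hwp hw₁ hw₂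
        have hc := (hconn Set.univ (Set.subset_univ _) (Set.subset_univ _)
          (Set.subset_univ _)).2 (connOn_univ_iff.2 hT.connected.preconnected)
        have := hH.nonempty
        refine (hmin' T' hT' ⟨connOn_univ_iff.1 hc⟩).not_gt ?_
        refine Finset.sum_lt_sum (fun u _ => ?_) ⟨w, Finset.mem_univ w, by omega⟩
        by_cases hu : u ∈ K₁ ∪ K₂
        · have := hd u hu
          omega
        · have := hd' u hu
          omega
      refine ⟨L, ⟨hdeg, hL, fun w hw => ?_⟩, hL₁ hx, hL₂ hy⟩
      by_cases hw₁ : w ∈ K₁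
      · exact h₁.exists_relax hL₁ hL hdeg hw₁
      by_cases hw₂ : w ∈ K₂
      · exact h₂.exists_relax hL₂ hL hdeg hw₂
      have hwp : w ∈ p.support := by
        rcases hw with (h | h) | h
        · exact absurd h hw₁
        · exact h
        · exact absurd h hw₂
      obtain ⟨T', hT', hconn, hd, hd', hdw⟩ :=
        h₁.exists_exchange hTH h₂ hdis hx hy hxy hp hwp hw₁ hw₂
      obtain ⟨hag, hc⟩ := hconn L hL₁ hL₂ hLp
      refine ⟨T', hT', hag, hc hL, fun u hu => ?_, hdw.trans_le (hdeg w hw)⟩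
      by_cases hu' : u ∈ K₁ ∪ K₂
      · exact hd u hu'
      · exact (hd' u hu').trans (hdeg u hu)
    · obtain ⟨z, hz₁, hz₂⟩ := Set.not_disjoint_iff.1 hdis
      exact ⟨K₁ ∪ K₂, h₁.union h₂ hz₁ hz₂, .inl hx, .inr hy⟩
  refine .inr ⟨{v | ∀ K, Relaxable H T k K → v ∉ K}, fun v hv => ?_, ⟨v₀, fun K hK hv => ?_, hv₀⟩,
    fun x hx y hy hxy => ?_⟩
  · by_contra! hlt
    exact hv _ (relaxable_singleton hTH hlt) rfl
  · exact hv₀.not_ge (hK.1 v₀ hv)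
  · simp only [Set.mem_ofPred_eq, not_forall, not_not] at hx hy
    obtain ⟨K₁, h₁, hx⟩ := hx
    obtain ⟨K₂, h₂, hy⟩ := hy
    obtain ⟨K, hK, hxK, hyK⟩ := hmeet x y K₁ K₂ hx hy h₁ h₂ hxy
    exact (hK.2.1 x hxK y hyK).mono le_rfl fun v hv h => h K hK hv

end Witness

/-- A tree rooted at `r` has a parent function decreasing a depth function. -/
lemma SimpleGraph.IsTree.exists_parent {V : Type} {T : SimpleGraph V} (hT : T.IsTree) (r : V) :
    ∃ (par : V → V) (d : V → ℕ), (∀ v, v ≠ r → T.Adj v (par v) ∧ d (par v) < d v) ∧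
      ∀ u v, T.Adj u v → (u ≠ r ∧ par u = v) ∨ (v ≠ r ∧ par v = u) := by
  choose P hP huniq using fun v => hT.existsUnique_path v r
  have hr : (P r).support = [r] := by rw [← huniq r .nil .nil]; rfl
  refine ⟨fun v => (P v).snd, fun v => (P v).length, fun v hv => ?_, fun u v huv => ?_⟩
  · have hnil : ¬ (P v).Nil := Walk.not_nil_of_ne hv
    refine ⟨(P v).adj_snd hnil, ?_⟩
    dsimp only
    rw [← huniq _ _ (hP v).tail]
    have := Walk.length_tail_add_one hnil
    omega
  · by_cases hv : v ∈ (P u).support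
    · refine .inl ⟨?_, (hT.isAcyclic.eq_snd_of_adj_start (hP u) huv hv).symm⟩
      rintro rfl
      rw [hr, List.mem_singleton] at hv
      exact huv.ne hv.symm
    · refine .inr ⟨?_, ?_⟩
      · rintro rfl
        exact hv (P u).end_mem_support
      · dsimp only
        rw [← huniq v (.cons huv.symm (P u)) ((hP u).cons hv), Walk.snd_cons]

section Contract

variable {V : Type} [Fintype V] [DecidableEq V]

/-- The degree sum over `S` in a rooted tree, counted through children. -/
lemma card_children_ge {T : SimpleGraph V} {S : Finset V} {r : V} (hr : r ∈ S) {par : V → V}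
    (hpar : ∀ u v, T.Adj u v → (u ≠ r ∧ par u = v) ∨ (v ≠ r ∧ par v = u)) {k : ℕ}
    (hdeg : ∀ v ∈ S, k ≤ (T.neighborSet v).ncard) (hrk : k < (T.neighborSet r).ncard) :
    k * S.card + 2 ≤ (Finset.univ.filter fun v => v ≠ r ∧ par v ∈ S).card + S.card := by
  classical
  have hsum : (Finset.univ.filter fun v => v ≠ r ∧ par v ∈ S).card =
      ∑ s ∈ S, (Finset.univ.filter fun v => v ≠ r ∧ par v = s).card := by
    rw [Finset.card_eq_sum_card_fiberwise (f := par) (t := S)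
      (fun v hv => by simpa using (Finset.mem_filter.1 hv).2.2)]
    refine Finset.sum_congr rfl fun s hs => congrArg _ (Finset.ext fun v => ?_)
    simp only [Finset.mem_filter, Finset.mem_univ, true_and]
    constructor
    · rintro ⟨⟨h1, -⟩, h2⟩
      exact ⟨h1, h2⟩
    · rintro ⟨h1, rfl⟩
      exact ⟨⟨h1, hs⟩, rfl⟩
  have hone : ∀ s ∈ S, k + (if s = r then 2 else 0) ≤
      (Finset.univ.filter fun v => v ≠ r ∧ par v = s).card + 1 := by
    intro s hs
    have hmem : ∀ v, T.Adj s v → v ≠ par s ∨ s = r →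
        v ∈ Finset.univ.filter fun v => v ≠ r ∧ par v = s := by
      intro v hv hvs
      rw [Finset.mem_filter]
      refine ⟨Finset.mem_univ v, ?_⟩
      rcases hpar s v hv with ⟨h1, h2⟩ | h
      · rcases hvs with h3 | h3
        · exact absurd h2.symm h3
        · exact absurd h3 h1
      · exact h
    split_ifs with hsr
    · subst hsr
      have : (T.neighborSet s).ncard ≤
          (Finset.univ.filter fun v => v ≠ s ∧ par v = s).card := by
        rw [← Set.ncard_coe_finset]
        exact Set.ncard_le_ncard fun v hv => hmem v hv (.inr rfl)
      omega
    · have : (T.neighborSet s).ncard ≤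
          (insert (par s) (Finset.univ.filter fun v => v ≠ r ∧ par v = s)).card := by
        rw [← Set.ncard_coe_finset]
        refine Set.ncard_le_ncard fun v hv => ?_
        rw [Finset.coe_insert]
        by_cases h : v = par s
        · exact .inl h
        · exact .inr (hmem v hv (.inl h))
      have h2 := Finset.card_insert_le (par s) (Finset.univ.filter fun v => v ≠ r ∧ par v = s)
      have := hdeg s hs
      omega
  have := Finset.sum_le_sum hone
  rw [Finset.sum_add_distrib, Finset.sum_add_distrib, Finset.sum_ite_eq' S r, if_pos hr, ← hsum]
    at this
  simp only [Finset.sum_const, smul_eq_mul, mul_one] at this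
  rw [mul_comm]
  exact this

/-- A spanning tree with a set `S` of high-degree vertices, such that every edge outside `S` is
spanned by the forest outside `S`, yields a `K_t`-minor. -/
theorem IsMinorOf.of_isTree_witness {t : ℕ} (ht : 5 ≤ t) {H T : SimpleGraph V}
    (hH : KConnected t H) (hTH : T ≤ H) (hT : T.IsTree) {S : Finset V}
    (hdeg : ∀ v ∈ S, t - 2 ≤ (T.neighborSet v).ncard)
    (hex : ∃ v ∈ S, t - 2 < (T.neighborSet v).ncard)
    (hedge : ∀ x ∉ S, ∀ y ∉ S, H.Adj x y → ReachIn T {v | v ∉ S} x y) :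
    IsMinorOf (⊤ : SimpleGraph (Fin t)) H := by
  classical
  obtain ⟨r, hr, hrk⟩ := hex
  obtain ⟨par, d, hpar, hadj⟩ := hT.exists_parent r
  have hne : ∀ v ∉ S, v ≠ r := by
    rintro v hv rfl
    exact hv hr
  obtain ⟨top, htop⟩ : ∃ top : V → V, ∀ v ∉ S,
      top v = if par v ∈ S then v else top (par v) := by
    refine ⟨(measure d).wf.fix fun v rec => if h : v ∉ S ∧ par v ∉ S then
      rec (par v) (hpar v (hne v h.1)).2 else v, fun v hv => ?_⟩
    rw [WellFounded.fix_eq]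
    by_cases h : par v ∈ S <;> simp [hv, h]
  have htopS : ∀ v ∉ S, top v ∉ S ∧ par (top v) ∈ S ∧ d (top v) ≤ d v ∧
      ReachIn T {u | u ∉ S ∧ top u = top v} v (top v) := by
    intro v
    induction hn : d v using Nat.strong_induction_on generalizing v with
    | _ n IH =>
    subst hn
    intro hv
    by_cases h : par v ∈ S
    · have h1 : top v = v := by rw [htop v hv, if_pos h]
      rw [h1]
      exact ⟨hv, h, le_rfl, .refl⟩
    · have h1 : top v = top (par v) := by rw [htop v hv, if_neg h]
      obtain ⟨h2, h3⟩ := hpar v (hne v hv)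
      obtain ⟨h4, h5, h6, h7⟩ := IH _ h3 (par v) rfl h
      rw [h1]
      exact ⟨h4, h5, h6.trans h3.le, (ReachIn.single h2 (.intro hv h1) (.intro h rfl)).trans h7⟩
  have htopT : ∀ u ∉ S, ∀ v ∉ S, T.Adj u v → top u = top v := by
    intro u hu v hv huv
    rcases hadj u v huv with ⟨-, rfl⟩ | ⟨-, rfl⟩
    · rw [htop u hu, if_neg hv]
    · rw [htop v hv, if_neg hu]
  have htopH : ∀ u ∉ S, ∀ v ∉ S, H.Adj u v → top u = top v := by
    intro u hu v hv huv
    by_contra h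
    obtain ⟨x, hx, y, hy, hxS, hyS, hxy⟩ :=
      (hedge u hu v hv huv).exists_exit (P := {w | top w = top u}) rfl (Ne.symm h)
    exact hy ((htopT x hxS y hyS hxy).symm.trans hx)
  let tops : Finset V := Finset.univ.filter fun v => v ∉ S ∧ par v ∈ S
  have htops : ∀ v ∈ tops, v ∉ S ∧ par v ∈ S ∧ top v = v := by
    intro v hv
    obtain ⟨h1, h2⟩ : v ∉ S ∧ par v ∈ S := by simpa [tops] using hv
    exact ⟨h1, h2, by rw [htop v h1, if_pos h2]⟩
  let A₀ : Finset V := (S.filter fun s => s ≠ r ∧ par s ∉ S).image fun s => top (par s)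
  let A : Finset V := tops \ A₀
  have hAmem : ∀ a ∈ A, a ∉ S ∧ top a = a ∧ a ∉ A₀ := fun a ha => by
    obtain ⟨h1, h2⟩ := Finset.mem_sdiff.1 ha
    exact ⟨(htops a h1).1, (htops a h1).2.2, h2⟩
  let q : V → V := fun v => if v ∈ S then v else if top v ∈ A₀ then par (top v) else top v
  have qS : ∀ s ∈ S, q s = s := fun s hs => if_pos hs
  have qA₀ : ∀ v ∉ S, top v ∈ A₀ → q v = par (top v) := fun v hv h => by simp [q, hv, h]
  have qA : ∀ v ∉ S, top v ∉ A₀ → q v = top v := fun v hv h => by simp [q, hv, h]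
  have hfib : ∀ w, ConnOn H (q ⁻¹' {w}) := by
    intro w
    refine connOn_of_root w ?_
    rintro u rfl
    by_cases hu : u ∈ S
    · rw [qS u hu]; exact .refl
    obtain ⟨h1, h2, -, h3⟩ := htopS u hu
    have h4 : ReachIn H (q ⁻¹' {q u}) u (top u) := h3.mono hTH fun v hv => by
      change q v = q u
      simp [q, hv.1, hv.2, hu]
    by_cases h : top u ∈ A₀
    · refine h4.trans ?_
      have h5 := (htop (top u) h1).trans (if_pos h2)
      have h6 : q (top u) = q u := by rw [qA₀ _ h1 (h5.symm ▸ h), h5, qA₀ u hu h]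
      rw [qA₀ u hu h] at h6 ⊢
      exact .single (hTH (hpar _ (hne _ h1)).1) h6 (qS _ h2)
    · rwa [qA u hu h] at h4 ⊢
  refine IsMinorOf.of_quotientGraph (by omega) hfib ?_
  have hcardA : (t - 4) * S.card < A.card ∧ 2 ≤ A.card := by
    have h1 := card_children_ge hr hadj hdeg hrk
    have h2 := Finset.card_filter_add_card_filter_not
      (s := Finset.univ.filter fun v => v ≠ r ∧ par v ∈ S) (· ∈ S)
    have h3 : ((Finset.univ.filter fun v => v ≠ r ∧ par v ∈ S).filter (¬ · ∈ S)).card =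
        tops.card := by
      congr 1
      ext v
      simp only [tops, Finset.mem_filter, Finset.mem_univ, true_and]
      exact ⟨fun h => ⟨h.2, h.1.2⟩, fun h => ⟨⟨hne v h.1, h.2⟩, h.1⟩⟩
    have h4 : ((Finset.univ.filter fun v => v ≠ r ∧ par v ∈ S).filter (· ∈ S)).card =
        ((S.erase r).filter fun s => par s ∈ S).card := by
      congr 1
      ext v
      simp only [Finset.mem_filter, Finset.mem_univ, true_and, Finset.mem_erase]
      tauto
    have h5 := Finset.card_filter_add_card_filter_not (s := S.erase r) (fun s => par s ∈ S)
    have h6 : ((S.erase r).filter fun s => ¬ par s ∈ S).card =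
        (S.filter fun s => s ≠ r ∧ par s ∉ S).card := by
      congr 1
      ext v
      simp only [Finset.mem_filter, Finset.mem_erase]
      tauto
    have h7 : A₀.card ≤ (S.filter fun s => s ≠ r ∧ par s ∉ S).card := Finset.card_image_le
    have h8 : tops.card - A₀.card ≤ A.card := Finset.le_card_sdiff _ _
    have h9 := Finset.card_erase_add_one hr
    obtain ⟨m, rfl⟩ := Nat.exists_eq_add_of_le ht
    have h10 : (5 + m - 2) * S.card = (5 + m - 4) * S.card + 2 * S.card := by
      rw [← add_mul]
      congr 1
      omega
    omega
  refine IsMinorOf.of_many_attachments ht (quotientGraph H q) S A ?_ ?_ ?_ hcardA.1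
  · exact Finset.disjoint_left.2 fun s hs ha => (hAmem s ha).1 hs
  · refine connOn_of_root r ?_
    intro s
    induction hn : d s using Nat.strong_induction_on generalizing s with
    | _ n IH =>
    subst hn
    intro hs
    by_cases hsr : s = r
    · rw [hsr]; exact .refl
    obtain ⟨h1, h2⟩ := hpar s hsr
    have hstep : ∀ u, q (par s) = u → u ∈ S → d u < d s →
        ReachIn (quotientGraph H q) S s r := by
      intro u hqu hu hdu
      have hsu : q s ≠ q (par s) := by
        rw [qS s hs, hqu]
        rintro rfl
        exact hdu.ne rfl
      have := quotientGraph_adj (hTH h1) hsu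
      rw [qS s hs, hqu] at this
      exact (ReachIn.single this hs (Finset.mem_coe.2 hu)).trans (IH _ hdu u rfl hu)
    by_cases hps : par s ∈ S
    · exact hstep _ (qS _ hps) hps h2
    · have hA₀ : top (par s) ∈ A₀ :=
        Finset.mem_image.2 ⟨s, Finset.mem_filter.2 ⟨hs, hsr, hps⟩, rfl⟩
      obtain ⟨h3, h4, h5, -⟩ := htopS _ hps
      have h6 := (hpar _ (hne _ h3)).2
      exact hstep _ (qA₀ _ hps hA₀) h4 (by omega)
  · intro a ha
    by_contra! hlt
    obtain ⟨a', ha', hne'⟩ := Finset.exists_mem_ne (by omega : 1 < A.card) a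
    obtain ⟨haS, hta, haA₀⟩ := hAmem a ha
    obtain ⟨haS', hta', -⟩ := hAmem a' ha'
    let N : Finset V := S.filter ((quotientGraph H q).Adj a)
    have hN : N.card < t := by convert hlt
    have hconn := hH.2 (N : Set V) (by rw [Set.ncard_coe_finset]; omega)
    have haN : a ∈ (N : Set V)ᶜ := fun h => haS (Finset.mem_filter.1 (Finset.mem_coe.1 h)).1
    have haN' : a' ∈ (N : Set V)ᶜ := fun h => haS' (Finset.mem_filter.1 (Finset.mem_coe.1 h)).1
    have hreach := connOn_iff_induce_preconnected.2 hconn.preconnected a haN a' haN'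
    obtain ⟨u, ⟨huS, hua⟩, v, hv, -, hvN, huv⟩ := hreach.exists_exit
      (P := {u | u ∉ S ∧ top u = a}) ⟨haS, hta⟩ (fun h => hne' (hta'.symm.trans h.2))
    by_cases hvS : v ∈ S
    · have hqu : q u = a := by rw [qA u huS (hua.symm ▸ haA₀), hua]
      have hqv := qS v hvS
      have := quotientGraph_adj (q := q) huv (by
        rw [hqu, hqv]
        rintro rfl
        exact haS hvS)
      rw [hqu, hqv] at this
      exact hvN (Finset.mem_coe.2 (Finset.mem_filter.2 ⟨hvS, this⟩))
    · exact hv ⟨hvS, (htopH u huS v hvS huv).symm.trans hua⟩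

end Contract

lemma isMinorOf_top_fin {V : Type} {G : SimpleGraph V} {t : ℕ} (B : Fin t → Set V)
    (hne : ∀ i, (B i).Nonempty) (hconn : ∀ i, ConnOn G (B i))
    (h : ∀ i j, i < j → Disjoint (B i) (B j) ∧ ∃ u ∈ B i, ∃ v ∈ B j, G.Adj u v) :
    IsMinorOf (⊤ : SimpleGraph (Fin t)) G := by
  refine ⟨B, hne, fun i => (hconn i).induce_connected (hne i), fun i j hij => ?_,
    fun i j hij => ?_⟩
  · rcases hij.lt_or_gt with hij | hij
    · exact (h i j hij).1
    · exact (h j i hij).1.symm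
  · rcases (Adj.ne hij).lt_or_gt with hij | hij
    · exact (h i j hij).2
    · obtain ⟨u, hu, v, hv, huv⟩ := (h j i hij).2
      exact ⟨v, hv, u, hu, huv.symm⟩

lemma IsMinorOf.top_fin_mono {V : Type} {G : SimpleGraph V} {s t : ℕ} (hst : s ≤ t)
    (h : IsMinorOf (⊤ : SimpleGraph (Fin t)) G) : IsMinorOf (⊤ : SimpleGraph (Fin s)) G := by
  obtain ⟨B, h1, h2, h3, h4⟩ := h
  refine ⟨B ∘ Fin.castLE hst, fun b => h1 _, fun b => h2 _,
    fun b b' hb => h3 ((Fin.castLE_injective hst).ne hb), fun b b' hb => h4 _ _ ?_⟩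
  simpa using hb

lemma KConnected.mono {V : Type} [Fintype V] {G : SimpleGraph V} {s t : ℕ} (hst : s ≤ t)
    (h : KConnected t G) : KConnected s G :=
  ⟨le_trans (by omega) h.1, fun S hS => h.2 S (hS.trans (by omega))⟩

lemma SimpleGraph.Walk.connOn_getVert {V : Type} {G : SimpleGraph V} {a b : V}
    (p : G.Walk a b) {i j : ℕ} (hj : j ≤ p.length) :
    ConnOn G (p.getVert '' Set.Icc i j) := by
  refine connOn_of_root (p.getVert i) ?_
  rintro _ ⟨m, ⟨hm, hmj⟩, rfl⟩
  induction m, hm using Nat.le_induction with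
  | base => exact .refl
  | succ m hm ih =>
    have hstep : ReachIn G (p.getVert '' Set.Icc i j) (p.getVert (m + 1)) (p.getVert m) :=
      .single (p.adj_getVert_succ (by omega)).symm ⟨m + 1, ⟨by omega, hmj⟩, rfl⟩
        ⟨m, ⟨hm, by omega⟩, rfl⟩
    exact hstep.trans (ih (by omega))

/-- Deleting a vertex from a 3-connected graph leaves a graph with a cycle. -/
lemma KConnected.exists_isCycle {V : Type} [Fintype V] {G : SimpleGraph V}
    (h : KConnected 3 G) (v : V) :
    ∃ (u : V) (c : G.Walk u u), c.IsCycle ∧ v ∉ c.support := by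
  classical
  suffices hcyc : ¬ (G.induce ({v}ᶜ : Set V)).IsAcyclic by
    simp only [IsAcyclic, not_forall, not_not] at hcyc
    obtain ⟨u, c, hc⟩ := hcyc
    refine ⟨_, c.map (Embedding.induce _).toHom, hc.map Subtype.val_injective, ?_⟩
    intro hv
    rw [Walk.support_map, List.mem_map] at hv
    obtain ⟨x, -, hx⟩ := hv
    exact x.2 hx
  intro hac
  obtain ⟨hcard, hconn⟩ := h
  have htree : (G.induce ({v}ᶜ : Set V)).IsTree := ⟨hconn {v} (by simp), hac⟩
  have hcard' : Fintype.card ({v}ᶜ : Set V) = Fintype.card V - 1 := by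
    rw [Fintype.card_compl_set]
    simp
  have : Nontrivial ({v}ᶜ : Set V) := Fintype.one_lt_card_iff_nontrivial.1 (by omega)
  obtain ⟨⟨x, hx⟩, hdeg⟩ := htree.exists_vert_degree_one_of_nontrivial
  obtain ⟨⟨y, hy⟩, hxy, huniq⟩ := degree_eq_one_iff_existsUnique_adj.1 hdeg
  obtain ⟨z, hz⟩ : ∃ z, z ∉ ({v, x, y} : Finset V) := by
    by_contra! hall
    have := Finset.card_le_card (fun z _ => hall z : (Finset.univ : Finset V) ⊆ {v, x, y})
    have h3 := Finset.card_le_three (a := v) (b := x) (c := y)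
    rw [Finset.card_univ] at this
    omega
  simp only [Finset.mem_insert, Finset.mem_singleton, not_or] at hz
  have hxy' : x ≠ y := fun h => hxy.ne (Subtype.ext h)
  have hS := connOn_iff_induce_preconnected.2 (hconn {v, y} (Set.ncard_insert_le v {y} |>.trans
    (by simp))).preconnected
  obtain ⟨u, hu, w, hw, -, hwS, huw⟩ :=
    (hS x (by simpa using ⟨hx, hxy'⟩) z (by simpa using ⟨hz.1, hz.2.2⟩)).exists_exit
      (P := {x}) rfl hz.2.1
  obtain rfl : u = x := hu
  simp only [Set.mem_compl_iff, Set.mem_insert_iff, Set.mem_singleton_iff, not_or] at hwS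
  exact hwS.2 (congrArg Subtype.val (huniq ⟨w, hwS.1⟩ huw))

theorem KConnected.isMinorOf_top_four {V : Type} [Fintype V] {G : SimpleGraph V}
    (h : KConnected 3 G) : IsMinorOf (⊤ : SimpleGraph (Fin 4)) G := by
  classical
  obtain ⟨v⟩ : Nonempty V := Fintype.card_pos_iff.1 (by have := h.1; omega)
  obtain ⟨u, c, hc, hv⟩ := h.exists_isCycle v
  let D : Set V := {x | ReachIn G {y | y ∉ c.support} v x}
  let N : Set V := {u | u ∈ c.support ∧ ∃ x ∈ D, G.Adj x u}
  have hDc : ∀ x ∈ D, x ∉ c.support := by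
    intro x hx hxc
    obtain ⟨_, -, y, hy, -, hy', -⟩ := ReachIn.exists_exit (P := {y | y ∉ c.support}) hx hv
      (by simpa using hxc)
    exact hy hy'
  have hN : 2 < N.ncard := by
    by_contra! hN2
    obtain ⟨z, hzc, hzN⟩ : ∃ z ∈ c.support, z ∉ N := by
      by_contra! hall
      have hsub : (Finset.range 3).image c.getVert ⊆ N.toFinset := by
        intro z hz
        obtain ⟨m, -, rfl⟩ := Finset.mem_image.1 hz
        exact Set.mem_toFinset.2 (hall _ (c.getVert_mem_support m))
      have h1 := Finset.card_le_card hsub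
      have h2 := hc.three_le_length
      rw [Finset.card_image_of_injOn, Finset.card_range, ← Set.ncard_eq_toFinset_card'] at h1
      · omega
      · refine hc.getVert_injOn'.mono fun m hm => ?_
        have : m < 3 := by simpa using hm
        change m ≤ c.length - 1
        omega
    have hS := connOn_iff_induce_preconnected.2 (h.2 N (by simpa using hN2)).preconnected
    obtain ⟨x, hx, y, hy, -, hyN, hxy⟩ := (hS v (fun h => hv h.1) z hzN).exists_exit
      (P := D) .refl fun hz => hDc z hz hzc
    by_cases hyc : y ∈ c.support
    · exact hyN ⟨hyc, x, hx, hxy⟩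
    · exact hy (ReachIn.trans hx (.single hxy (hDc x hx) hyc))
  obtain ⟨a, b₁, b₂, ⟨ha, xa, hxa, hxa'⟩, ⟨hb₁, x₁, hx₁, hx₁'⟩, ⟨hb₂, x₂, hx₂, hx₂'⟩, hab₁, hab₂,
    hb₁₂⟩ := (Set.two_lt_ncard_iff).1 hN
  have hc' : (c.rotate a ha).IsCycle := by simpa using hc
  have hmem : ∀ x, x ∈ (c.rotate a ha).support ↔ x ∈ c.support := fun x =>
    Walk.mem_support_rotate_iff c a ha
  rw [← hmem] at hb₁ hb₂
  have hD' : ∀ x ∈ D, x ∉ (c.rotate a ha).support := fun x hx hx' =>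
    hDc x hx ((hmem x).1 hx')
  generalize c.rotate a ha = p at hc' hb₁ hb₂ hD'
  have hlen := hc'.three_le_length
  obtain ⟨i, hi, hil⟩ := Walk.mem_support_iff_exists_getVert.1 hb₁
  obtain ⟨j, hj, hjl⟩ := Walk.mem_support_iff_exists_getVert.1 hb₂
  have hinj := hc'.getVert_injOn
  have hpos : ∀ m, p.getVert m ≠ a → m ≠ 0 ∧ m ≠ p.length := by
    intro m hm
    constructor
    · rintro rfl
      exact hm p.getVert_zero
    · rintro rfl
      exact hm p.getVert_length
  have hi' := hpos i (by rw [hi]; exact hab₁.symm)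
  have hj' := hpos j (by rw [hj]; exact hab₂.symm)
  have hij : i ≠ j := by
    rintro rfl
    exact hb₁₂ (hi.symm.trans hj)
  have hexD : ∀ m, p.getVert m ∈ ({b₁, b₂} : Set V) → ∃ x ∈ D, G.Adj x (p.getVert m) := by
    rintro m (hm | hm)
    · rw [hm]; exact ⟨x₁, hx₁, hx₁'⟩
    · rw [hm]; exact ⟨x₂, hx₂, hx₂'⟩
  obtain ⟨i, j, hi0, hij, hjl, hxi, hxj⟩ : ∃ i j, 0 < i ∧ i < j ∧ j < p.length ∧
      (∃ x ∈ D, G.Adj x (p.getVert i)) ∧ ∃ x ∈ D, G.Adj x (p.getVert j) := by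
    rcases hij.lt_or_gt with hij | hij
    · exact ⟨i, j, by omega, hij, by omega, hexD i (.inl hi), hexD j (.inr hj)⟩
    · exact ⟨j, i, by omega, hij, by omega, hexD j (.inr hj), hexD i (.inl hi)⟩
  have hDconn : ConnOn G D := by
    refine connOn_of_root v fun x hx => ReachIn.symm ?_
    have : ∀ y, ReachIn G {y | y ∉ c.support} v y → ReachIn G D v y := by
      intro y hy
      induction hy with
      | refl => exact .refl
      | tail h1 h2 ih =>
        exact ih.trans (.single h2.1 h1 (ReachIn.trans h1 (.single h2.1 h2.2.1 h2.2.2)))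
    exact this x hx
  have hDp : ∀ s : Set ℕ, Disjoint D (p.getVert '' s) := fun s => by
    refine Set.disjoint_left.2 ?_
    rintro x hx ⟨m, -, rfl⟩
    exact hD' _ hx (p.getVert_mem_support m)
  have ha0 : a = p.getVert p.length := p.getVert_length.symm
  have harc : ∀ s s' : Set ℕ, s ⊆ Set.Icc 1 p.length → s' ⊆ Set.Icc 1 p.length →
      Disjoint s s' → Disjoint (p.getVert '' s) (p.getVert '' s') := by
    intro s s' hs hs' hdis
    refine Set.disjoint_left.2 ?_
    rintro _ ⟨m, hm, rfl⟩ ⟨m', hm', hmm⟩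
    obtain rfl := hinj (hs' hm') (hs hm) hmm
    exact Set.disjoint_left.1 hdis hm hm'
  refine isMinorOf_top_fin
    ![D, p.getVert '' Set.Icc p.length p.length, p.getVert '' Set.Icc 1 (j - 1),
      p.getVert '' Set.Icc j (p.length - 1)] ?_ ?_ ?_
  · intro k
    fin_cases k
    · exact ⟨v, .refl⟩
    · exact ⟨_, _, ⟨le_rfl, le_rfl⟩, rfl⟩
    · exact ⟨_, i, ⟨by omega, by omega⟩, rfl⟩
    · exact ⟨_, j, ⟨by omega, by omega⟩, rfl⟩
  · intro k
    fin_cases k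
    · exact hDconn
    · exact p.connOn_getVert le_rfl
    · exact p.connOn_getVert (by omega)
    · exact p.connOn_getVert (by omega)
  · have h01 : ∃ u ∈ D, ∃ w ∈ p.getVert '' Set.Icc p.length p.length, G.Adj u w :=
      ⟨xa, hxa, a, ⟨p.length, by simp, ha0.symm⟩, hxa'⟩
    have h02 : ∃ u ∈ D, ∃ w ∈ p.getVert '' Set.Icc 1 (j - 1), G.Adj u w := by
      obtain ⟨x, hx, hxi⟩ := hxi
      exact ⟨x, hx, _, ⟨i, ⟨by omega, by omega⟩, rfl⟩, hxi⟩
    have h03 : ∃ u ∈ D, ∃ w ∈ p.getVert '' Set.Icc j (p.length - 1), G.Adj u w := by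
      obtain ⟨x, hx, hxj⟩ := hxj
      exact ⟨x, hx, _, ⟨j, ⟨by omega, by omega⟩, rfl⟩, hxj⟩
    have h12 : ∃ u ∈ p.getVert '' Set.Icc p.length p.length,
        ∃ w ∈ p.getVert '' Set.Icc 1 (j - 1), G.Adj u w := by
      refine ⟨a, ⟨p.length, by simp, ha0.symm⟩, _, ⟨1, ⟨by omega, by omega⟩, rfl⟩, ?_⟩
      simpa using p.adj_getVert_succ (i := 0) (by omega)
    have h13 : ∃ u ∈ p.getVert '' Set.Icc p.length p.length,
        ∃ w ∈ p.getVert '' Set.Icc j (p.length - 1), G.Adj u w := by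
      refine ⟨_, ⟨p.length, by simp, rfl⟩, _, ⟨p.length - 1, ⟨by omega, by omega⟩, rfl⟩, ?_⟩
      have := p.adj_getVert_succ (i := p.length - 1) (by omega)
      rw [Nat.sub_add_cancel (by omega)] at this
      exact this.symm
    have h23 : ∃ u ∈ p.getVert '' Set.Icc 1 (j - 1),
        ∃ w ∈ p.getVert '' Set.Icc j (p.length - 1), G.Adj u w := by
      refine ⟨_, ⟨j - 1, ⟨by omega, by omega⟩, rfl⟩, _, ⟨j, ⟨by omega, by omega⟩, rfl⟩, ?_⟩
      have := p.adj_getVert_succ (i := j - 1) (by omega)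
      rwa [Nat.sub_add_cancel (by omega)] at this
    have hs1 : Set.Icc p.length p.length ⊆ Set.Icc 1 p.length :=
      Set.Icc_subset_Icc (by omega) le_rfl
    have hs2 : Set.Icc 1 (j - 1) ⊆ Set.Icc 1 p.length :=
      Set.Icc_subset_Icc le_rfl (by omega)
    have hs3 : Set.Icc j (p.length - 1) ⊆ Set.Icc 1 p.length :=
      Set.Icc_subset_Icc (by omega) (by omega)
    have hd12 : Disjoint (Set.Icc p.length p.length) (Set.Icc 1 (j - 1)) :=
      Set.disjoint_left.2 fun m hm hm' => by have := hm.1; have := hm'.2; omega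
    have hd13 : Disjoint (Set.Icc p.length p.length) (Set.Icc j (p.length - 1)) :=
      Set.disjoint_left.2 fun m hm hm' => by have := hm.1; have := hm'.2; omega
    have hd23 : Disjoint (Set.Icc 1 (j - 1)) (Set.Icc j (p.length - 1)) :=
      Set.disjoint_left.2 fun m hm hm' => by have := hm.2; have := hm'.1; omega
    intro k l hkl
    fin_cases k <;> fin_cases l <;> first | exact absurd hkl (by decide) | skip
    · exact ⟨hDp _, h01⟩
    · exact ⟨hDp _, h02⟩
    · exact ⟨hDp _, h03⟩
    · exact ⟨harc _ _ hs1 hs2 hd12, h12⟩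
    · exact ⟨harc _ _ hs1 hs3 hd13, h13⟩
    · exact ⟨harc _ _ hs2 hs3 hd23, h23⟩

/-- For `t ≤ 4` every `t`-connected graph has a `K_t`-minor. -/
theorem KConnected.isMinorOf_of_le_four {V : Type} [Fintype V] {G : SimpleGraph V} {t : ℕ}
    (ht : 1 ≤ t) (ht4 : t ≤ 4) (h : KConnected t G) :
    IsMinorOf (⊤ : SimpleGraph (Fin t)) G := by
  by_cases ht3 : 3 ≤ t
  · exact (h.mono ht3).isMinorOf_top_four.top_fin_mono ht4
  have hconn : ConnOn G Set.univ := by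
    have := connOn_iff_induce_preconnected.2 (h.2 ∅ (by simp)).preconnected
    rwa [Set.compl_empty] at this
  obtain ⟨x, y, hxy⟩ := Fintype.one_lt_card_iff.1 (by have := h.1; omega : 1 < Fintype.card V)
  obtain ⟨u, hu, v, hv, -, -, huv⟩ :=
    (hconn x trivial y trivial).exists_exit (P := {x}) rfl hxy.symm
  refine IsMinorOf.top_fin_mono (t := 2) (by omega)
    (isMinorOf_top_fin ![{u}, {v}] ?_ ?_ ?_)
  · intro i
    fin_cases i <;> simp
  · intro i
    fin_cases i <;> exact connOn_singleton G _
  · intro i j hij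
    obtain ⟨rfl, rfl⟩ : i = 0 ∧ j = 1 := by omega
    exact ⟨by simpa using huv.ne, u, rfl, v, rfl, huv⟩

/-- Spanning trees of bounded degree in `t`-connected graphs with no
`K_t`-minor.  For every `t ≥ 1` there is a constant `C = C(t)` such that every
`t`-connected graph `H` with no `K_t`-minor and at least `C` vertices has a spanning
tree of maximum degree at most `t − 2`. -/
theorem spanning_tree_of_K_t_minor_free (t : ℕ) (ht : 1 ≤ t) :
    ∃ C : ℕ, ∀ (V : Type) [Fintype V], ∀ H : SimpleGraph V,
      KConnected t H →
      ¬ IsMinorOf (⊤ : SimpleGraph (Fin t)) H →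
      C ≤ Fintype.card V →
      ∃ T : SimpleGraph V, T ≤ H ∧ T.IsTree ∧
        ∀ v : V, (T.neighborSet v).ncard ≤ t - 2 := by
  classical
  refine ⟨0, fun V _ H hH hno _ => ?_⟩
  rcases le_or_gt t 4 with ht4 | ht5
  · exact absurd (hH.isMinorOf_of_le_four ht ht4) hno
  have hconn : H.Connected := by
    have h := hH.2 ∅ (by simp)
    obtain ⟨x⟩ := h.nonempty
    have h' := connOn_iff_induce_preconnected.2 h.preconnected
    rw [Set.compl_empty] at h'
    exact (connected_iff _).2 ⟨connOn_univ_iff.1 h', ⟨x⟩⟩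
  obtain ⟨T, hTH, hT, hdeg | ⟨S, hS, hex, hedge⟩⟩ := exists_isTree_witness hconn (t - 2)
  · exact ⟨T, hTH, hT, hdeg⟩
  refine absurd (IsMinorOf.of_isTree_witness ht5 hH hTH hT (S := S.toFinset) ?_ ?_ ?_) hno
  · simpa using hS
  · simpa using hex
  · simp only [Set.mem_toFinset]
    exact hedge
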